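/- There is an absolute constant C > 0 such that for every integer k ≥ 2 and every weighted multigraph on a vertex set V with |V| = n ≥ k and λ_k > 0, the number of k-cuts of weight exactly λ_k (i.e., minimum-weight k-cuts) is at most n^k · k^{C·k²}. -/

import Mathlib

open Finset

/-- The weight of a `k`-cut, viewed as a finite partition `P` of the vertex set:
the sum of `w u v` over unordered pairs `{u, v}` lying in different parts
(each ordered pair is counted once in the double sum, hence the factor `1/2`). -/
noncomputable def kCutWeight {V : Type*} [Fintype V] [DecidableEq V] (w : V → V → ℝ)
    (P : Finpartition (univ : Finset V)) : ℝ :=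
  (1 / 2) * ∑ u, ∑ v, if ∃ p ∈ P.parts, u ∈ p ∧ v ∈ p then (0 : ℝ) else w u v

namespace KCut

section Cost

variable {V : Type*} [Fintype V]

open Classical in
/-- The total weight of the ordered pairs satisfying `R`. -/
noncomputable def cost (w : V → V → ℝ) (R : V → V → Prop) : ℝ :=
  ∑ x, ∑ y, if R x y then w x y else 0

/-- The total weight of the ordered pairs separated by the set `S`. -/
noncomputable def cut (w : V → V → ℝ) (S : Finset V) : ℝ :=
  cost w fun x y => ¬(x ∈ S ↔ y ∈ S)

/-- The total weight of the ordered pairs receiving different colours. -/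
noncomputable def colorCost {β : Type*} (w : V → V → ℝ) (f : V → β) : ℝ :=
  cost w fun x y => f x ≠ f y

variable {w : V → V → ℝ}

lemma cost_nonneg (hw : ∀ x y, 0 ≤ w x y) (R : V → V → Prop) : 0 ≤ cost w R :=
  sum_nonneg fun x _ => sum_nonneg fun y _ => by split_ifs <;> simp [hw]

lemma cost_mono (hw : ∀ x y, 0 ≤ w x y) {R R' : V → V → Prop} (h : ∀ x y, R x y → R' x y) :
    cost w R ≤ cost w R' := by
  refine sum_le_sum fun x _ => sum_le_sum fun y _ => ?_
  by_cases h1 : R x y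
  · simp [h1, h x y h1]
  · simp only [h1, if_false]
    split_ifs <;> simp [hw]

lemma cost_congr {R R' : V → V → Prop} (h : ∀ x y, R x y ↔ R' x y) :
    cost w R = cost w R' := by
  have : R = R' := by ext x y; exact h x y
  rw [this]

lemma cost_or {R R' R'' : V → V → Prop} (h : ∀ x y, R x y ↔ R' x y ∨ R'' x y)
    (hd : ∀ x y, R' x y → ¬R'' x y) : cost w R = cost w R' + cost w R'' := by
  unfold cost
  simp only [← sum_add_distrib]
  refine sum_congr rfl fun x _ => sum_congr rfl fun y _ => ?_
  have h1 := h x y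
  have h2 := hd x y
  by_cases h3 : R' x y <;> by_cases h4 : R'' x y <;> simp_all

lemma cost_add_le (hw : ∀ x y, 0 ≤ w x y) {R R' R'' : V → V → Prop}
    (h1 : ∀ x y, R' x y → R x y) (h2 : ∀ x y, R'' x y → R x y)
    (hd : ∀ x y, R' x y → ¬R'' x y) : cost w R' + cost w R'' ≤ cost w R := by
  rw [← cost_or (R := fun x y => R' x y ∨ R'' x y) (fun _ _ => Iff.rfl) hd]
  exact cost_mono hw fun x y h => h.elim (h1 x y) (h2 x y)

lemma sum_cost {ι : Type*} (s : Finset ι) (R : ι → V → V → Prop)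
    [∀ i x y, Decidable (R i x y)] :
    ∑ i ∈ s, cost w (R i) = ∑ x, ∑ y, (#{i ∈ s | R i x y} : ℝ) * w x y := by
  unfold cost
  rw [sum_comm]
  refine sum_congr rfl fun x _ => ?_
  rw [sum_comm]
  refine sum_congr rfl fun y _ => ?_
  rw [card_filter, Nat.cast_sum, sum_mul]
  refine sum_congr rfl fun i _ => ?_
  by_cases h : R i x y <;> simp [h]

lemma exists_nat_coloring {β : Type*} (f : V → β) :
    ∃ g : V → ℕ, ∀ x y, g x = g y ↔ f x = f y := by
  classical
  have : Countable (Set.range f) := (Set.finite_range f).countable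
  obtain ⟨e, he⟩ := Countable.exists_injective_nat (Set.range f)
  refine ⟨fun x => e ⟨f x, Set.mem_range_self x⟩, fun x y => ?_⟩
  rw [he.eq_iff, Subtype.mk.injEq]

lemma card_image_eq_of_kernel {α β : Type*} [DecidableEq α] [DecidableEq β] {f : V → α} {g : V → β}
    (h : ∀ x y, g x = g y ↔ f x = f y) : #(univ.image g) = #(univ.image f) := by
  classical
  rcases isEmpty_or_nonempty V with hV | ⟨⟨v⟩⟩
  · simp [univ_eq_empty]
  have : Nonempty β := ⟨g v⟩
  have h1 : ∀ a ∈ univ.image f, ∃ b, ∀ x, f x = a → g x = b := by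
    intro a ha
    obtain ⟨x, -, rfl⟩ := mem_image.1 ha
    exact ⟨g x, fun y hy => (h y x).2 hy⟩
  choose! e he using h1
  have : univ.image g = (univ.image f).image e := by
    ext b
    simp only [mem_image, mem_univ, true_and, exists_exists_eq_and]
    constructor
    · rintro ⟨x, rfl⟩
      exact ⟨x, (he (f x) (by simp) x rfl).symm⟩
    · rintro ⟨x, rfl⟩
      exact ⟨x, he (f x) (by simp) x rfl⟩
  rw [this, card_image_of_injOn]
  intro a ha b hb hab
  obtain ⟨x, -, rfl⟩ := mem_image.1 (mem_coe.1 ha)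
  obtain ⟨y, -, rfl⟩ := mem_image.1 (mem_coe.1 hb)
  rw [← he _ (by simp) x rfl, ← he _ (by simp) y rfl] at hab
  exact (h x y).1 hab

lemma colorCost_eq_of_kernel {α β : Type*} {f : V → α} {g : V → β}
    (h : ∀ x y, g x = g y ↔ f x = f y) : colorCost w g = colorCost w f :=
  cost_congr fun x y => not_congr (h x y)

/-- A lower bound for the cost of colourings with natural number colours holds for all colourings. -/
lemma le_colorCost {β : Type*} [DecidableEq β] {k : ℕ} {r : ℝ}
    (h : ∀ f : V → ℕ, #(univ.image f) = k → r ≤ colorCost w f) (f : V → β)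
    (hf : #(univ.image f) = k) : r ≤ colorCost w f := by
  obtain ⟨g, hg⟩ := exists_nat_coloring f
  rw [← colorCost_eq_of_kernel hg]
  exact h g ((card_image_eq_of_kernel hg).trans hf)

/-- The weight inside colour class `a` of the colouring `c` separated by `T`. -/
noncomputable def innerCost (w : V → V → ℝ) (c : V → ℕ) (a : ℕ) (T : Finset V) : ℝ :=
  cost w fun x y => c x = a ∧ c y = a ∧ ¬(x ∈ T ↔ y ∈ T)

lemma innerCost_add_le (hw : ∀ x y, 0 ≤ w x y) (c : V → ℕ) {a b : ℕ} (hab : a ≠ b) (T : Finset V) :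
    innerCost w c a T + innerCost w c b T ≤ cut w T :=
  cost_add_le hw (fun _ _ h => h.2.2) (fun _ _ h => h.2.2)
    fun _ _ h h' => hab (h.1.symm.trans h'.1)

lemma innerCost_le_cut (hw : ∀ x y, 0 ≤ w x y) (c : V → ℕ) (a : ℕ) (T : Finset V) :
    innerCost w c a T ≤ cut w T :=
  cost_mono hw fun _ _ h => h.2.2

lemma innerCost_compl [DecidableEq V] (c : V → ℕ) (a : ℕ) (T : Finset V) :
    innerCost w c a Tᶜ = innerCost w c a T :=
  cost_congr fun x y => by simp only [mem_compl, not_iff_not]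

lemma cut_compl [DecidableEq V] (T : Finset V) : cut w Tᶜ = cut w T :=
  cost_congr fun x y => by simp only [mem_compl, not_iff_not]

/-- Splitting the colour class `a` along `T`; the points of the class in `T` get a new colour. -/
lemma exists_split (c : V → ℕ) {a : ℕ} {T : Finset V} {x₀ y₀ : V}
    (hx : c x₀ = a) (hxT : x₀ ∈ T) (hy : c y₀ = a) (hyT : y₀ ∉ T) :
    ∃ c' : V → ℕ, #(univ.image c') = #(univ.image c) + 1 ∧
      colorCost w c' = colorCost w c + innerCost w c a T ∧
      (∀ x, c x ≠ a → c' x = c x) ∧ (∀ x, x ∉ T → c' x = c x) ∧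
      ∀ x y, c' x = c' y → c x = c y := by
  classical
  obtain ⟨N, hN⟩ := Infinite.exists_notMem_finset (univ.image c)
  have hN' : ∀ x, c x ≠ N := fun x hx => hN (by simp [← hx])
  have hk : ∀ x y, (if c x = a ∧ x ∈ T then N else c x) = (if c y = a ∧ y ∈ T then N else c y) ↔
      c x = c y ∧ ¬(c x = a ∧ c y = a ∧ ¬(x ∈ T ↔ y ∈ T)) := by
    intro x y
    have h1 := hN' x
    have h2 := hN' y
    grind
  refine ⟨fun x => if c x = a ∧ x ∈ T then N else c x, ?_, ?_, ?_, ?_, ?_⟩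
  · rw [← card_insert_of_notMem hN]
    congr 1
    ext b
    simp only [mem_image, mem_univ, true_and, mem_insert]
    constructor
    · rintro ⟨x, rfl⟩
      split_ifs <;> simp
    · rintro (rfl | ⟨x, rfl⟩)
      · exact ⟨x₀, by simp [hx, hxT]⟩
      · by_cases h : c x = a ∧ x ∈ T
        · exact ⟨y₀, by simp [hy, hyT, h.1]⟩
        · exact ⟨x, by simp [h]⟩
  · refine cost_or (fun x y => ?_) fun x y h h' => h (h'.1.trans h'.2.1.symm)
    simp only [ne_eq]
    rw [hk]
    tauto
  · intro x hx
    simp [hx]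
  · intro x hx
    simp [hx]
  · intro x y h
    exact ((hk x y).1 h).1

end Cost

section Star

lemma card_filter_add_card_filter_le {ι : Type*} [DecidableEq ι] {I A B : Finset ι} (m : ℕ)
    (hA : A ⊆ I) (hB : B ⊆ I) :
    #{z ∈ I | ¬((z ∈ A ∧ #A = 1) ↔ (z ∈ B ∧ #B = 1))} + #{j ∈ Icc 3 m | ¬(j ≤ #A ↔ j ≤ #B)} ≤
      #{z ∈ I | ¬(z ∈ A ↔ z ∈ B)} := by
  wlog hab : #A ≤ #B generalizing A B
  · have := this hB hA (le_of_not_ge hab)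
    have e1 : ∀ p q : Prop, (¬(p ↔ q)) = ¬(q ↔ p) := fun p q => by rw [iff_comm]
    simp only [e1 (_ ∧ #B = 1), e1 (_ ≤ #B), e1 (_ ∈ B)] at this
    exact this
  have h2 : #{j ∈ Icc 3 m | ¬(j ≤ #A ↔ j ≤ #B)} ≤ #B - max #A 2 := by
    rw [← Nat.card_Ioc]
    refine card_le_card fun j hj => ?_
    simp only [mem_filter, mem_Icc, mem_Ioc] at hj ⊢
    omega
  have h3 : #B - #A ≤ #{z ∈ I | ¬(z ∈ A ↔ z ∈ B)} := by
    refine (le_card_sdiff A B).trans (card_le_card fun z hz => ?_)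
    rw [mem_sdiff] at hz
    simp [hB hz.1, hz]
  by_cases h4 : #A = 1 ∧ #B = 1
  · simp [h4]
  have h1 : #{z ∈ I | ¬((z ∈ A ∧ #A = 1) ↔ (z ∈ B ∧ #B = 1))} ≤
      if #A = 1 ∨ #B = 1 then 1 else 0 := by
    split_ifs with h
    · rcases h with h | h
      · have h' : #B ≠ 1 := fun h' => h4 ⟨h, h'⟩
        rw [← h]
        refine card_le_card fun z hz => ?_
        simpa [h', h] using (mem_filter.1 hz).2
      · have h' : #A ≠ 1 := fun h' => h4 ⟨h', h⟩
        rw [← h]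
        refine card_le_card fun z hz => ?_
        simpa [h', h] using (mem_filter.1 hz).2
    · push Not at h
      simp [h]
  split_ifs at h1 <;> omega

variable {V : Type*} [Fintype V] [DecidableEq V] {w : V → V → ℝ} {θ : ℝ} {k : ℕ}

/-- If the sets `P z`, `z ∈ J`, are nonempty, pairwise disjoint and do not cover `V`, then together
with the rest they form a colouring. -/
lemma le_sum_cut_of_disjoint (hw : ∀ x y, 0 ≤ w x y)
    (h2 : ∀ f : V → ℕ, #(univ.image f) = k → (k : ℝ) * θ ≤ colorCost w f)
    {ι : Type*} [DecidableEq ι] {J : Finset ι} (hJ : #J + 1 = k) (P : ι → Finset V)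
    (hP : ∀ z ∈ J, (P z).Nonempty) (hd : ∀ z ∈ J, ∀ z' ∈ J, ∀ x, x ∈ P z → x ∈ P z' → z = z')
    {u : V} (hu : ∀ z ∈ J, u ∉ P z) : (k : ℝ) * θ ≤ ∑ z ∈ J, cut w (P z) := by
  classical
  have hf : ∀ x, ∃ o : Option ι, (∀ z ∈ J, x ∈ P z ↔ o = some z) ∧ ∀ z, o = some z → z ∈ J := by
    intro x
    by_cases h : ∃ z ∈ J, x ∈ P z
    · obtain ⟨z, hz, hx⟩ := h
      refine ⟨some z, fun z' hz' => ⟨fun h => congrArg some (hd z hz z' hz' x hx h), ?_⟩, ?_⟩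
      · intro h
        rwa [← Option.some.inj h]
      · intro z' h
        rwa [← Option.some.inj h]
    · push Not at h
      exact ⟨none, fun z hz => by simp [h z hz], by simp⟩
  choose f hf hf' using hf
  have him : univ.image f = insertNone J := by
    ext o
    simp only [mem_image, mem_univ, true_and]
    constructor
    · rintro ⟨x, rfl⟩
      rw [mem_insertNone]
      intro z hz
      exact hf' x z hz
    · intro ho
      rcases o with _ | z
      · refine ⟨u, ?_⟩
        rcases h : f u with _ | z
        · rfl
        · exact absurd ((hf u z (hf' u z h)).2 h) (hu z (hf' u z h))
      · have hz : z ∈ J := by simpa using ho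
        obtain ⟨x, hx⟩ := hP z hz
        exact ⟨x, (hf x z hz).1 hx⟩
  refine (le_colorCost h2 f (by rw [him, card_insertNone, hJ])).trans ?_
  unfold cut
  rw [sum_cost]
  unfold colorCost cost
  refine sum_le_sum fun x _ => sum_le_sum fun y _ => ?_
  split_ifs with h
  · refine le_mul_of_one_le_left (hw x y) ?_
    rw [Nat.one_le_cast, Nat.one_le_iff_ne_zero, ← Nat.pos_iff_ne_zero, card_pos]
    have key : ∀ x y, f x ≠ f y → ∀ z, f x = some z →
        ({z ∈ J | ¬(x ∈ P z ↔ y ∈ P z)} : Finset ι).Nonempty := by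
      intro x y h z hz
      have hzJ := hf' x z hz
      refine ⟨z, mem_filter.2 ⟨hzJ, ?_⟩⟩
      rw [hf x z hzJ, hf y z hzJ]
      intro h'
      exact h (hz.trans (h'.1 hz).symm)
    rcases hx : f x with _ | z
    · rcases hy : f y with _ | z
      · exact absurd (hx.trans hy.symm) h
      · obtain ⟨z', hz'⟩ := key y x (Ne.symm h) z hy
        rw [mem_filter, iff_comm] at hz'
        exact ⟨z', mem_filter.2 hz'⟩
    · exact key x y h z hx
  · exact mul_nonneg (Nat.cast_nonneg _) (hw x y)

/-- There is no family of `2 (k - 1)` small sets with a common point, a common non-point, and each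
having a private point. -/
lemma no_star (hw : ∀ x y, 0 ≤ w x y) (hk : 2 ≤ k)
    (h1 : ∀ X : Finset V, X.Nonempty → X ≠ univ → θ < cut w X)
    (h2 : ∀ f : V → ℕ, #(univ.image f) = k → (k : ℝ) * θ ≤ colorCost w f)
    {I : Finset V} (hI : #I = 2 * (k - 1)) {S : V → Finset V} {u v : V}
    (hS : ∀ z ∈ I, cut w (S z) < 2 * θ) (hu : ∀ z ∈ I, u ∈ S z) (hv : ∀ z ∈ I, v ∉ S z)
    (hz : ∀ z ∈ I, z ∈ S z) (hz' : ∀ z ∈ I, ∀ z' ∈ I, z' ≠ z → z' ∉ S z) : False := by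
  classical
  set A : V → Finset V := fun x => {z ∈ I | x ∈ S z} with hA
  have hAu : A u = I := filter_true_of_mem hu
  have hAv : A v = ∅ := filter_false_of_mem hv
  have hAz : ∀ z ∈ I, A z = {z} := by
    intro z hzI
    ext x
    simp only [hA, mem_filter, mem_singleton]
    constructor
    · rintro ⟨hx, h⟩
      by_contra hne
      exact hz' x hx z hzI (Ne.symm hne) h
    · rintro rfl
      exact ⟨hzI, hz x hzI⟩
  set P : V → Finset V := fun z => {x | z ∈ A x ∧ #(A x) = 1} with hP
  set L : ℕ → Finset V := fun j => {x | j ≤ #(A x)} with hL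
  have hsum : ∑ z ∈ I, cut w (P z) + ∑ j ∈ Icc 3 #I, cut w (L j) ≤ ∑ z ∈ I, cut w (S z) := by
    unfold cut
    rw [sum_cost, sum_cost, sum_cost]
    simp only [← sum_add_distrib]
    refine sum_le_sum fun x _ => sum_le_sum fun y _ => ?_
    rw [← add_mul]
    refine mul_le_mul_of_nonneg_right ?_ (hw x y)
    have := card_filter_add_card_filter_le #I (filter_subset (fun z => x ∈ S z) I)
      (filter_subset (fun z => y ∈ S z) I)
    have e : ({z ∈ I | ¬(x ∈ S z ↔ y ∈ S z)} : Finset V) =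
        {z ∈ I | ¬(z ∈ A x ↔ z ∈ A y)} := by
      refine filter_congr fun z hz => ?_
      simp [hA, hz]
    rw [e]
    simp only [hP, hL, mem_filter_univ]
    exact_mod_cast this
  have hPgroup : ∀ J ⊆ I, #J + 1 = k → (k : ℝ) * θ ≤ ∑ z ∈ J, cut w (P z) := by
    intro J hJ hJk
    refine le_sum_cut_of_disjoint hw h2 hJk P ?_ ?_ (u := u) ?_
    · intro z hz
      refine ⟨z, ?_⟩
      simp [hP, hAz z (hJ hz)]
    · intro z _ z' _ x hx hx'
      simp only [hP, mem_filter_univ] at hx hx'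
      exact card_le_one.1 hx.2.le z hx.1 z' hx'.1
    · intro z hz
      simp only [hP, mem_filter_univ, hAu, hI]
      omega
  obtain ⟨J, hJ, hJc⟩ := exists_subset_card_eq (s := I) (n := k - 1) (by omega)
  have hJ1 := hPgroup J hJ (by omega)
  have hJ2 := hPgroup (I \ J) sdiff_subset (by rw [card_sdiff_of_subset hJ]; omega)
  have hJ3 : ∑ z ∈ I, cut w (P z) = ∑ z ∈ I \ J, cut w (P z) + ∑ z ∈ J, cut w (P z) :=
    (sum_sdiff hJ).symm
  have hLs : ∑ j ∈ Icc 3 #I, θ ≤ ∑ j ∈ Icc 3 #I, cut w (L j) := by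
    refine sum_le_sum fun j hj => (h1 _ ⟨u, ?_⟩ ?_).le
    · rw [mem_Icc] at hj
      simp [hL, hAu, hj.2]
    · intro h
      have : v ∈ L j := h ▸ mem_univ v
      rw [mem_Icc] at hj
      simp only [hL, mem_filter_univ, hAv, card_empty] at this
      omega
  have hIne : I.Nonempty := by
    rw [← card_pos]
    omega
  have hSs : ∑ z ∈ I, cut w (S z) < ∑ z ∈ I, 2 * θ := sum_lt_sum_of_nonempty hIne hS
  rw [sum_const, nsmul_eq_mul] at hLs hSs
  have hc1 : ((#(Icc 3 #I) : ℕ) : ℝ) = 2 * k - 4 := by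
    rw [Nat.card_Icc, hI]
    have : 2 * (k - 1) + 1 - 3 + 4 = 2 * k := by omega
    have : ((2 * (k - 1) + 1 - 3 : ℕ) : ℝ) + 4 = 2 * k := by exact_mod_cast this
    linarith
  have hc2 : (#I : ℝ) = 2 * k - 2 := by
    rw [hI]
    have : 2 * (k - 1) + 2 = 2 * k := by omega
    have : ((2 * (k - 1) : ℕ) : ℝ) + 2 = 2 * k := by exact_mod_cast this
    linarith
  rw [hc1] at hLs
  rw [hc2] at hSs
  linarith

end Star

/-- The recursive bound on the size of antichains of small sets. -/
def chainBound (m : ℕ) : ℕ → ℕ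
  | 0 => 1
  | L + 1 => m * m * chainBound m L + 1

lemma chainBound_pos (m L : ℕ) : 0 < chainBound m L := by
  cases L <;> simp [chainBound]

section Width

variable {V : Type*} [Fintype V] [DecidableEq V] {w : V → V → ℝ} {θ : ℝ} {k : ℕ}

lemma exists_minimal_hitting_set (ℬ : Finset (Finset V)) (h : ∀ B ∈ ℬ, B.Nonempty) :
    ∃ H : Finset V, (∀ B ∈ ℬ, ∃ y ∈ H, y ∈ B) ∧
      ∀ y ∈ H, ∃ B ∈ ℬ, y ∈ B ∧ ∀ y' ∈ H, y' ≠ y → y' ∉ B := by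
  have hne : ({H | ∀ B ∈ ℬ, ∃ y ∈ H, y ∈ B} : Finset (Finset V)).Nonempty := by
    refine ⟨univ, mem_filter.2 ⟨mem_univ _, fun B hB => ?_⟩⟩
    obtain ⟨y, hy⟩ := h B hB
    exact ⟨y, mem_univ y, hy⟩
  obtain ⟨H, hH, hmin⟩ := exists_min_image _ card hne
  rw [mem_filter_univ] at hH
  refine ⟨H, hH, fun y hy => ?_⟩
  by_contra! hcon
  have := hmin (H.erase y) ?_
  · exact absurd (card_erase_lt_of_mem hy) (not_lt.2 this)
  · rw [mem_filter_univ]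
    intro B hB
    obtain ⟨z, hz, hzB⟩ := hH B hB
    by_cases hzy : z = y
    · subst hzy
      obtain ⟨y', hy', hne, hyB⟩ := hcon B hB hzB
      exact ⟨y', mem_erase.2 ⟨hne, hy'⟩, hyB⟩
    · exact ⟨z, mem_erase.2 ⟨hzy, hz⟩, hzB⟩

/-- Among the small sets of an antichain other than `X₁`, a positive fraction agrees on a point of
`X₁` they avoid and on a point outside `X₁` they contain. -/
lemma exists_common_points (hw : ∀ x y, 0 ≤ w x y) (hk : 2 ≤ k)
    (h1 : ∀ X : Finset V, X.Nonempty → X ≠ univ → θ < cut w X)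
    (h2 : ∀ f : V → ℕ, #(univ.image f) = k → (k : ℝ) * θ ≤ colorCost w f)
    {u v : V} {𝒜 : Finset (Finset V)} (hne : 𝒜.Nonempty) {X₁ : Finset V}
    (hX₁ : ∀ X ∈ 𝒜, ¬X₁ ⊆ X ∧ ¬X ⊆ X₁)
    (hS : ∀ X ∈ 𝒜, cut w X < 2 * θ) (hu : ∀ X ∈ 𝒜, u ∈ X) (hv : ∀ X ∈ 𝒜, v ∉ X) {n : ℕ}
    (hn : 2 * (k - 1) * (2 * (k - 1)) * n ≤ #𝒜) :
    ∃ y z, y ∈ X₁ ∧ z ∉ X₁ ∧ n ≤ #{X ∈ 𝒜 | y ∉ X ∧ z ∈ X} := by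
  obtain ⟨Y, hY, hY'⟩ := exists_minimal_hitting_set (𝒜.image fun X => X₁ \ X) (by
    simp only [mem_image, forall_exists_index, and_imp, forall_apply_eq_imp_iff₂]
    intro X hX
    exact sdiff_nonempty.2 (hX₁ X hX).1)
  obtain ⟨Z, hZ, hZ'⟩ := exists_minimal_hitting_set (𝒜.image fun X => X \ X₁) (by
    simp only [mem_image, forall_exists_index, and_imp, forall_apply_eq_imp_iff₂]
    intro X hX
    exact sdiff_nonempty.2 (hX₁ X hX).2)
  simp only [mem_image, forall_exists_index, and_imp, forall_apply_eq_imp_iff₂, mem_sdiff,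
    exists_exists_and_eq_and] at hY hY' hZ hZ'
  have hYc : #Y ≤ 2 * (k - 1) := by
    by_contra! hlt
    obtain ⟨I, hI, hIc⟩ := exists_subset_card_eq hlt.le
    choose! S hS1 hS2 hS3 using hY'
    refine no_star hw hk h1 h2 hIc (S := fun z => (S z)ᶜ) (u := v) (v := u) ?_ ?_ ?_ ?_ ?_
    · intro z hz
      rw [cut_compl]
      exact hS _ (hS1 z (hI hz))
    · intro z hz
      exact mem_compl.2 (hv _ (hS1 z (hI hz)))
    · intro z hz
      rw [mem_compl, not_not]
      exact hu _ (hS1 z (hI hz))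
    · intro z hz
      exact mem_compl.2 (hS2 z (hI hz)).2
    · intro z hz z' hz' hne
      rw [mem_compl, not_not]
      by_contra hcon
      exact hS3 z (hI hz) z' (hI hz') hne ⟨(hS2 z' (hI hz')).1, hcon⟩
  have hZc : #Z ≤ 2 * (k - 1) := by
    by_contra! hlt
    obtain ⟨I, hI, hIc⟩ := exists_subset_card_eq hlt.le
    choose! S hS1 hS2 hS3 using hZ'
    refine no_star hw hk h1 h2 hIc (S := S) (u := u) (v := v) ?_ ?_ ?_ ?_ ?_
    · exact fun z hz => hS _ (hS1 z (hI hz))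
    · exact fun z hz => hu _ (hS1 z (hI hz))
    · exact fun z hz => hv _ (hS1 z (hI hz))
    · exact fun z hz => (hS2 z (hI hz)).1
    · intro z hz z' hz' hne hcon
      exact hS3 z (hI hz) z' (hI hz') hne ⟨hcon, (hS2 z' (hI hz')).2⟩
  have : Nonempty V := ⟨u⟩
  choose! y hy hyX using hY
  choose! z hz hzX using hZ
  have hmaps : ∀ X ∈ 𝒜, (y X, z X) ∈ Y ×ˢ Z := fun X hX => mem_product.2 ⟨hy X hX, hz X hX⟩
  obtain ⟨X₀, hX₀⟩ := hne
  obtain ⟨⟨y₀, z₀⟩, hyz, hcard⟩ := exists_le_card_fiber_of_mul_le_card_of_maps_to hmaps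
    ⟨_, hmaps X₀ hX₀⟩ (n := n) (by
      rw [card_product]
      exact (Nat.mul_le_mul_right n (Nat.mul_le_mul hYc hZc)).trans hn)
  rw [mem_product] at hyz
  refine ⟨y₀, z₀, ?_, ?_, hcard.trans (card_le_card fun X hX => ?_)⟩
  · obtain ⟨X, hX, h, -⟩ := hY' y₀ hyz.1
    exact h.1
  · obtain ⟨X, hX, h, -⟩ := hZ' z₀ hyz.2
    exact h.2
  · rw [mem_filter, Prod.mk.injEq] at hX
    rw [mem_filter, ← hX.2.1, ← hX.2.2]
    exact ⟨hX.1, (hyX X hX.1).2, (hzX X hX.1).1⟩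

lemma exists_coloring_of_antichain (hw : ∀ x y, 0 ≤ w x y) (hk : 2 ≤ k)
    (h1 : ∀ X : Finset V, X.Nonempty → X ≠ univ → θ < cut w X)
    (h2 : ∀ f : V → ℕ, #(univ.image f) = k → (k : ℝ) * θ ≤ colorCost w f)
    {u v : V} (L : ℕ) {𝒜 : Finset (Finset V)} (hanti : IsAntichain (· ⊆ ·) (𝒜 : Set (Finset V)))
    (hS : ∀ X ∈ 𝒜, cut w X < 2 * θ) (hu : ∀ X ∈ 𝒜, u ∈ X) (hv : ∀ X ∈ 𝒜, v ∉ X)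
    (hL : chainBound (2 * (k - 1)) L ≤ #𝒜) :
    ∃ c : V → ℕ, #(univ.image c) = L + 2 ∧ colorCost w c < (L + 2 : ℕ) * θ ∧ c u ≠ c v ∧
      (∀ x, (∀ X ∈ 𝒜, x ∈ X) → c x = c u) ∧ ∀ x, (∀ X ∈ 𝒜, x ∉ X) → c x = c v := by
  have hpos : 0 < #𝒜 := (chainBound_pos _ _).trans_le hL
  obtain ⟨X₁, hX₁⟩ := card_pos.1 hpos
  induction L generalizing 𝒜 X₁ with
  | zero =>
    refine ⟨fun x => if x ∈ X₁ then 1 else 0, ?_, ?_, ?_, ?_, ?_⟩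
    · have : univ.image (fun x => if x ∈ X₁ then 1 else 0) = ({0, 1} : Finset ℕ) := by
        ext b
        simp only [mem_image, mem_univ, true_and, mem_insert, mem_singleton]
        constructor
        · rintro ⟨x, rfl⟩
          split_ifs <;> simp
        · rintro (rfl | rfl)
          · exact ⟨v, by simp [hv X₁ hX₁]⟩
          · exact ⟨u, by simp [hu X₁ hX₁]⟩
      rw [this]
      rfl
    · have : colorCost w (fun x => if x ∈ X₁ then 1 else 0) = cut w X₁ :=
        cost_congr fun x y => by by_cases hx : x ∈ X₁ <;> by_cases hy : y ∈ X₁ <;> simp [hx, hy]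
      rw [this]
      exact_mod_cast hS X₁ hX₁
    · simp [hu X₁ hX₁, hv X₁ hX₁]
    · intro x hx
      simp [hx X₁ hX₁, hu X₁ hX₁]
    · intro x hx
      simp [hx X₁ hX₁, hv X₁ hX₁]
  | succ L ih =>
    have hsub : 𝒜.erase X₁ ⊆ 𝒜 := erase_subset _ _
    have hlt : 2 * (k - 1) * (2 * (k - 1)) * chainBound (2 * (k - 1)) L ≤ #(𝒜.erase X₁) := by
      rw [card_erase_of_mem hX₁]
      unfold chainBound at hL
      omega
    have hne : (𝒜.erase X₁).Nonempty := by
      refine card_pos.1 (lt_of_lt_of_le ?_ hlt)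
      have := chainBound_pos (2 * (k - 1)) L
      have : 0 < 2 * (k - 1) := by omega
      positivity
    obtain ⟨y, z, hy, hz, hcard⟩ := exists_common_points hw hk h1 h2 (u := u) (v := v) hne
      (X₁ := X₁) (fun X hX => ⟨hanti hX₁ (hsub hX) (ne_of_mem_erase hX).symm,
        hanti (hsub hX) hX₁ (ne_of_mem_erase hX)⟩)
      (fun X hX => hS X (hsub hX)) (fun X hX => hu X (hsub hX)) (fun X hX => hv X (hsub hX)) hlt
    set 𝒜' : Finset (Finset V) := {X ∈ 𝒜.erase X₁ | y ∉ X ∧ z ∈ X} with h𝒜'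
    have hsub' : 𝒜' ⊆ 𝒜 := (filter_subset _ _).trans hsub
    have hpos' : 0 < #𝒜' := (chainBound_pos _ _).trans_le hcard
    obtain ⟨X₂, hX₂⟩ := card_pos.1 hpos'
    obtain ⟨c, hc, hcost, huv, hcu, hcv⟩ := ih (hanti.subset (coe_subset.2 hsub'))
      (fun X hX => hS X (hsub' hX)) (fun X hX => hu X (hsub' hX)) (fun X hX => hv X (hsub' hX))
      hcard hpos' X₂ hX₂
    have hzc : c z = c u := hcu z fun X hX => (mem_filter.1 hX).2.2
    have hyc : c y = c v := hcv y fun X hX => (mem_filter.1 hX).2.1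
    have hadd := innerCost_add_le hw c huv X₁
    have hX₁S := hS X₁ hX₁
    have hcu' : ∀ x, (∀ X ∈ 𝒜, x ∈ X) → c x = c u := fun x hx => hcu x fun X hX => hx X (hsub' hX)
    have hcv' : ∀ x, (∀ X ∈ 𝒜, x ∉ X) → c x = c v := fun x hx => hcv x fun X hX => hx X (hsub' hX)
    by_cases hcase : innerCost w c (c u) X₁ < θ
    · obtain ⟨c', hc', hcost', hn1, hn2, -⟩ := exists_split (w := w) c (a := c u) (T := X₁ᶜ)
        (x₀ := z) (y₀ := u) hzc (by simpa using hz) rfl (by simpa using hu X₁ hX₁)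
      have e1 : c' u = c u := hn2 u (by simpa using hu X₁ hX₁)
      have e2 : c' v = c v := hn1 v huv.symm
      refine ⟨c', by omega, ?_, by rwa [e1, e2], ?_, ?_⟩
      · rw [hcost', innerCost_compl]
        push_cast at hcost ⊢
        linarith
      · intro x hx
        rw [e1, ← hcu' x hx]
        exact hn2 x (by simpa using hx X₁ hX₁)
      · intro x hx
        rw [e2, ← hcv' x hx]
        exact hn1 x (by rw [hcv' x hx]; exact huv.symm)
    · obtain ⟨c', hc', hcost', hn1, hn2, -⟩ := exists_split (w := w) c (a := c v) (T := X₁)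
        (x₀ := y) (y₀ := v) hyc hy rfl (hv X₁ hX₁)
      have e1 : c' u = c u := hn1 u huv
      have e2 : c' v = c v := hn2 v (hv X₁ hX₁)
      refine ⟨c', by omega, ?_, by rwa [e1, e2], ?_, ?_⟩
      · rw [hcost']
        push_cast at hcost ⊢
        linarith
      · intro x hx
        rw [e1, ← hcu' x hx]
        exact hn1 x (by rw [hcu' x hx]; exact huv)
      · intro x hx
        rw [e2, ← hcv' x hx]
        exact hn2 x (hx X₁ hX₁)

/-- Antichains of small sets with a common point and a common non-point are bounded. -/
lemma card_antichain_lt (hw : ∀ x y, 0 ≤ w x y) (hk : 2 ≤ k)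
    (h1 : ∀ X : Finset V, X.Nonempty → X ≠ univ → θ < cut w X)
    (h2 : ∀ f : V → ℕ, #(univ.image f) = k → (k : ℝ) * θ ≤ colorCost w f)
    {u v : V} {𝒜 : Finset (Finset V)} (hanti : IsAntichain (· ⊆ ·) (𝒜 : Set (Finset V)))
    (hS : ∀ X ∈ 𝒜, cut w X < 2 * θ) (hu : ∀ X ∈ 𝒜, u ∈ X) (hv : ∀ X ∈ 𝒜, v ∉ X) :
    #𝒜 < chainBound (2 * (k - 1)) (k - 2) := by
  by_contra! hcon
  obtain ⟨c, hc, hcost, -⟩ := exists_coloring_of_antichain hw hk h1 h2 (k - 2) hanti hS hu hv hcon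
  rw [Nat.sub_add_cancel hk] at hc hcost
  exact absurd (h2 c hc) (not_le.2 hcost)

/-- For each small set `S` there is a colouring with fewer than `k` colours refining `S` such that
every small set splits at most one colour class. -/
lemma exists_refining_coloring (hw : ∀ x y, 0 ≤ w x y) (hk : 2 ≤ k)
    (h2 : ∀ f : V → ℕ, #(univ.image f) = k → (k : ℝ) * θ ≤ colorCost w f)
    {S : Finset V} (hS : cut w S < 2 * θ) (hne : S.Nonempty) (huniv : S ≠ univ) :
    ∃ q : V → ℕ, #(univ.image q) ≤ k ∧ (∀ x y, q x = q y → (x ∈ S ↔ y ∈ S)) ∧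
      ∀ T, cut w T < 2 * θ → ∀ x y x' y', q x = q y → q x' = q y' → q x ≠ q x' →
        ¬(x ∈ T ↔ y ∈ T) → (x' ∈ T ↔ y' ∈ T) := by
  classical
  set Pr : ℕ → Prop := fun p => ∃ q : V → ℕ, #(univ.image q) = p ∧ colorCost w q < p * θ ∧
    ∀ x y, q x = q y → (x ∈ S ↔ y ∈ S) with hPr
  have h0 : Pr 2 := by
    obtain ⟨u, hu⟩ := hne
    obtain ⟨v, hv⟩ : ∃ v, v ∉ S := by
      by_contra! h
      exact huniv (eq_univ_iff_forall.2 h)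
    refine ⟨fun x => if x ∈ S then 1 else 0, ?_, ?_, ?_⟩
    · have : univ.image (fun x => if x ∈ S then 1 else 0) = ({0, 1} : Finset ℕ) := by
        ext b
        simp only [mem_image, mem_univ, true_and, mem_insert, mem_singleton]
        constructor
        · rintro ⟨x, rfl⟩
          split_ifs <;> simp
        · rintro (rfl | rfl)
          · exact ⟨v, by simp [hv]⟩
          · exact ⟨u, by simp [hu]⟩
      rw [this]
      rfl
    · have : colorCost w (fun x => if x ∈ S then 1 else 0) = cut w S :=
        cost_congr fun x y => by by_cases hx : x ∈ S <;> by_cases hy : y ∈ S <;> simp [hx, hy]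
      rw [this]
      exact_mod_cast hS
    · intro x y h
      by_cases hx : x ∈ S <;> by_cases hy : y ∈ S <;> simp_all
  obtain ⟨q, hq, hcost, href⟩ : Pr (Nat.findGreatest Pr k) := Nat.findGreatest_spec hk h0
  have hle := Nat.findGreatest_le (P := Pr) k
  have hgr : ∀ p, Nat.findGreatest Pr k < p → p ≤ k → ¬Pr p :=
    fun p hp hpk => Nat.findGreatest_is_greatest hp hpk
  set p := Nat.findGreatest Pr k with hp
  have hpk : p ≠ k := by
    intro h
    rw [h] at hq hcost
    exact absurd (h2 q hq) (not_le.2 hcost)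
  refine ⟨q, hq.trans_le hle, href, fun T hT x y x' y' hxy hxy' hne hx => ?_⟩
  by_contra hx'
  have hadd := innerCost_add_le hw q hne T
  have key : ∀ x y, q x = q y → ¬(x ∈ T ↔ y ∈ T) → θ ≤ innerCost w q (q x) T := by
    intro x y hxy hx
    by_contra! hlt
    have : ∃ q' : V → ℕ, #(univ.image q') = #(univ.image q) + 1 ∧
        colorCost w q' = colorCost w q + innerCost w q (q x) T ∧
        ∀ x y, q' x = q' y → q x = q y := by
      by_cases hxT : x ∈ T
      · obtain ⟨q', h1, h2, -, -, h3⟩ := exists_split (w := w) q (x₀ := x) (y₀ := y) rfl hxT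
          hxy.symm (by tauto)
        exact ⟨q', h1, h2, h3⟩
      · obtain ⟨q', h1, h2, -, -, h3⟩ := exists_split (w := w) q (x₀ := y) (y₀ := x) hxy.symm
          (by tauto) rfl hxT
        exact ⟨q', h1, h2, h3⟩
    obtain ⟨q', h1, h2, h3⟩ := this
    refine hgr (p + 1) (Nat.lt_succ_self p) (by omega) ⟨q', by omega, ?_, ?_⟩
    · push_cast
      linarith
    · exact fun x y h => href x y (h3 x y h)
  have k1 := key x y hxy hx
  have k2 := key x' y' hxy' hx'
  linarith

end Width

section Trace

variable {V : Type*} [Fintype V] [DecidableEq V]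

/-- A family of subsets of `U` closed under complements, with antichains between two points bounded
by `α`, and with `k`-coloured refinements of its members. -/
structure TraceFamily (α k : ℕ) (U : Finset V) (𝓕 : Finset (Finset V)) : Prop where
  subset : ∀ T ∈ 𝓕, T ⊆ U
  compl : ∀ T ∈ 𝓕, U \ T ∈ 𝓕
  width : ∀ u ∈ U, ∀ v ∈ U, ∀ 𝒜 ⊆ 𝓕, IsAntichain (· ⊆ ·) (𝒜 : Set (Finset V)) →
    (∀ X ∈ 𝒜, u ∈ X) → (∀ X ∈ 𝒜, v ∉ X) → #𝒜 ≤ α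
  refine : ∀ S ∈ 𝓕, ∃ q : V → ℕ, #(univ.image q) ≤ k ∧
    (∀ x ∈ U, ∀ y ∈ U, q x = q y → (x ∈ S ↔ y ∈ S)) ∧
    ∀ T ∈ 𝓕, ∀ x ∈ U, ∀ y ∈ U, ∀ x' ∈ U, ∀ y' ∈ U, q x = q y → q x' = q y' → q x ≠ q x' →
      ¬(x ∈ T ↔ y ∈ T) → (x' ∈ T ↔ y' ∈ T)

namespace TraceFamily

variable {α k : ℕ} {U : Finset V} {𝓕 : Finset (Finset V)}

lemma card_le_of_card_mem (h : TraceFamily α k U 𝓕) {u v : V} (hu : u ∈ U) (hv : v ∈ U)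
    {𝒢 : Finset (Finset V)} (h𝒢 : 𝒢 ⊆ 𝓕) (hu' : ∀ X ∈ 𝒢, u ∈ X) (hv' : ∀ X ∈ 𝒢, v ∉ X)
    {R : Finset ℕ} (hR : ∀ X ∈ 𝒢, #X ∈ R) : #𝒢 ≤ α * #R := by
  refine card_le_mul_card_image_of_maps_to hR α fun r _ => ?_
  refine h.width u hu v hv _ ((filter_subset _ _).trans h𝒢) ?_ ?_ ?_
  · intro X hX Y hY hne hXY
    rw [mem_coe, mem_filter] at hX hY
    exact hne (eq_of_subset_of_card_le hXY (by rw [hX.2, hY.2]))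
  · exact fun X hX => hu' X (mem_filter.1 hX).1
  · exact fun X hX => hv' X (mem_filter.1 hX).1

lemma erase (h : TraceFamily α k U 𝓕) (y : V) :
    TraceFamily α k (U.erase y) (𝓕.image fun T => T.erase y) where
  subset := by
    simp only [mem_image, forall_exists_index, and_imp, forall_apply_eq_imp_iff₂]
    exact fun T hT => erase_subset_erase y (h.subset T hT)
  compl := by
    simp only [mem_image, forall_exists_index, and_imp, forall_apply_eq_imp_iff₂]
    intro T hT
    refine ⟨U \ T, h.compl T hT, ?_⟩
    ext x
    simp only [mem_erase, mem_sdiff]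
    tauto
  width := by
    intro u hu v hv 𝒜 h𝒜 hanti hu' hv'
    have hex : ∀ X ∈ 𝒜, ∃ T ∈ 𝓕, T.erase y = X := fun X hX => mem_image.1 (h𝒜 hX)
    choose! t ht htX using hex
    have hinj : Set.InjOn t 𝒜 := by
      intro X hX Y hY hXY
      rw [← htX X hX, ← htX Y hY, hXY]
    rw [← card_image_of_injOn hinj]
    rw [mem_erase] at hu hv
    refine h.width u hu.2 v hv.2 _ ?_ ?_ ?_ ?_
    · simp only [image_subset_iff]
      exact ht
    · intro A hA B hB hne hAB
      rw [coe_image] at hA hB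
      obtain ⟨X, hX, rfl⟩ := hA
      obtain ⟨Y, hY, rfl⟩ := hB
      refine hanti hX hY (fun h => hne (by rw [h])) ?_
      change X ⊆ Y
      rw [← htX X hX, ← htX Y hY]
      exact erase_subset_erase y hAB
    · simp only [mem_image, forall_exists_index, and_imp, forall_apply_eq_imp_iff₂]
      intro X hX
      have := hu' X hX
      rw [← htX X hX] at this
      exact mem_of_mem_erase this
    · simp only [mem_image, forall_exists_index, and_imp, forall_apply_eq_imp_iff₂]
      intro X hX hcon
      have := hv' X hX
      rw [← htX X hX] at this
      exact this (mem_erase.2 ⟨hv.1, hcon⟩)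
  refine := by
    simp only [mem_image, forall_exists_index, and_imp, forall_apply_eq_imp_iff₂]
    intro S hS
    obtain ⟨q, hq, hqS, hqT⟩ := h.refine S hS
    refine ⟨q, hq, ?_, ?_⟩
    · intro x hx x' hx' hxx'
      rw [mem_erase] at hx hx'
      simpa [hx.1, hx'.1] using hqS x hx.2 x' hx'.2 hxx'
    · intro T hT x hx y hy x' hx' y' hy' h1 h2 h3
      rw [mem_erase] at hx hy hx' hy'
      simpa [hx.1, hx'.1, hy.1, hy'.1] using hqT T hT x hx.2 y hy.2 x' hx'.2 y' hy'.2 h1 h2 h3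

/-- The number of members of the family that stay in the family when `y` is removed. -/
def coll (𝓕 : Finset (Finset V)) (y : V) : ℕ := #{T ∈ 𝓕 | y ∈ T ∧ T.erase y ∈ 𝓕}

omit [Fintype V] in
lemma card_le_card_image_erase_add (𝓕 : Finset (Finset V)) (y : V) :
    #𝓕 ≤ #(𝓕.image fun T => T.erase y) + coll 𝓕 y := by
  have h1 := card_filter_add_card_filter_not (s := 𝓕) (fun T => y ∈ T ∧ T.erase y ∈ 𝓕)
  have h2 : #{T ∈ 𝓕 | ¬(y ∈ T ∧ T.erase y ∈ 𝓕)} ≤ #(𝓕.image fun T => T.erase y) := by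
    rw [← card_image_of_injOn (s := {T ∈ 𝓕 | ¬(y ∈ T ∧ T.erase y ∈ 𝓕)})
      (f := fun T => T.erase y) ?_]
    · exact card_le_card (image_subset_image (filter_subset _ _))
    · intro A hA B hB hAB
      rw [mem_coe, mem_filter] at hA hB
      dsimp only at hAB
      by_cases hyA : y ∈ A <;> by_cases hyB : y ∈ B
      · rw [← insert_erase hyA, ← insert_erase hyB, hAB]
      · rw [erase_eq_of_notMem hyB] at hAB
        exact absurd ⟨hyA, hAB ▸ hB.1⟩ hA.2
      · rw [erase_eq_of_notMem hyA] at hAB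
        exact absurd ⟨hyB, hAB ▸ hA.1⟩ hB.2
      · rwa [erase_eq_of_notMem hyA, erase_eq_of_notMem hyB] at hAB
  unfold coll
  omega

/-- The case where all members have few points or few non-points. -/
lemma card_le_of_small (h : TraceFamily α k U 𝓕) {s : ℕ} (hs : s ≤ #U)
    (hsmall : ∀ S ∈ 𝓕, #S < s ∨ #(U \ S) < s) : #𝓕 ≤ 2 * (#U * s * (α * s) + 1) := by
  obtain ⟨W, hW, hWc⟩ := exists_subset_card_eq hs
  have h1 : #{S ∈ 𝓕 | #S < s} ≤ #U * s * (α * s) + 1 := by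
    have hsub : ({S ∈ 𝓕 | #S < s} : Finset (Finset V)) ⊆ insert ∅ ((U ×ˢ W).biUnion fun p =>
        {S ∈ 𝓕 | #S < s ∧ p.1 ∈ S ∧ p.2 ∉ S}) := by
      intro S hS
      rw [mem_filter] at hS
      rw [mem_insert]
      rcases S.eq_empty_or_nonempty with rfl | ⟨u, hu⟩
      · exact Or.inl rfl
      · right
        obtain ⟨v, hv, hvS⟩ : ∃ v ∈ W, v ∉ S := by
          by_contra! hcon
          have := card_le_card (show W ⊆ S from hcon)
          omega
        rw [mem_biUnion]
        exact ⟨(u, v), mem_product.2 ⟨h.subset S hS.1 hu, hv⟩,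
          mem_filter.2 ⟨hS.1, hS.2, hu, hvS⟩⟩
    refine (card_le_card hsub).trans ((card_insert_le _ _).trans (Nat.add_le_add_right ?_ 1))
    rw [← hWc, ← card_product, hWc]
    refine card_biUnion_le_card_mul _ _ _ fun p hp => ?_
    rw [mem_product] at hp
    have := h.card_le_of_card_mem hp.1 (hW hp.2) (𝒢 := {S ∈ 𝓕 | #S < s ∧ p.1 ∈ S ∧ p.2 ∉ S})
      (filter_subset _ _) (fun X hX => (mem_filter.1 hX).2.2.1) (fun X hX => (mem_filter.1 hX).2.2.2)
      (R := range s) (fun X hX => mem_range.2 (mem_filter.1 hX).2.1)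
    rwa [card_range] at this
  have h2 : #{S ∈ 𝓕 | #(U \ S) < s} ≤ #{S ∈ 𝓕 | #S < s} := by
    refine card_le_card_of_injOn (fun S => U \ S) ?_ ?_
    · intro S hS
      rw [mem_coe, mem_filter] at hS ⊢
      exact ⟨h.compl S hS.1, hS.2⟩
    · intro S hS T hT hST
      rw [mem_coe, mem_filter] at hS hT
      dsimp only at hST
      rw [← Finset.sdiff_sdiff_eq_self (h.subset S hS.1), hST,
        Finset.sdiff_sdiff_eq_self (h.subset T hT.1)]
  have h3 : #𝓕 ≤ #{S ∈ 𝓕 | #S < s} + #{S ∈ 𝓕 | #(U \ S) < s} := by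
    rw [← card_filter_add_card_filter_not (s := 𝓕) (fun S => #S < s)]
    refine Nat.add_le_add_left (card_le_card fun S hS => ?_) _
    rw [mem_filter] at hS ⊢
    exact ⟨hS.1, (hsmall S hS.1).resolve_left hS.2⟩
  omega

/-- If `S` is minimal among the members with at least `2 k` points and non-points, then some point
of `S` has few collisions. -/
lemma exists_coll_le (h : TraceFamily α k U 𝓕) (hk : 1 ≤ k) {S : Finset V} (hS : S ∈ 𝓕)
    (hS1 : 2 * k ≤ #S) (hS2 : 2 * k ≤ #(U \ S))
    (hmin : ∀ T ∈ 𝓕, 2 * k ≤ #T → 2 * k ≤ #(U \ T) → #S ≤ #T) :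
    ∃ y ∈ S, coll 𝓕 y ≤ 4 * 2 ^ k * α * α + 2 * (α * (2 * k) + 1) := by
  obtain ⟨q, hq, hqS, hqT⟩ := h.refine S hS
  have hSU := h.subset S hS
  obtain ⟨v, hv⟩ : (U \ S).Nonempty := card_pos.1 (by omega)
  rw [mem_sdiff] at hv
  set G : Finset V := {y ∈ S | ∃ x ∈ U, q x = q y ∧ x ≠ y} with hG
  have hGc : #S ≤ 2 * #G := by
    have h1 : #G + #{y ∈ S | ¬∃ x ∈ U, q x = q y ∧ x ≠ y} = #S :=
      card_filter_add_card_filter_not (s := S) (fun y => ∃ x ∈ U, q x = q y ∧ x ≠ y)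
    have h2 : #{y ∈ S | ¬∃ x ∈ U, q x = q y ∧ x ≠ y} ≤ k := by
      refine le_trans ?_ hq
      refine card_le_card_of_injOn q (fun y _ => by simp) ?_
      intro a ha b hb hab
      rw [mem_coe, mem_filter] at ha hb
      by_contra hne
      exact hb.2 ⟨a, hSU ha.1, hab, hne⟩
    omega
  set closed : Finset V → Prop := fun T =>
    ∀ x ∈ U, ∀ x' ∈ U, q x = q x' → x ∉ S → x ∈ T → x' ∈ T with hclosed
  classical
  set 𝓗 : Finset (Finset V) := {T ∈ 𝓕 | ¬T ⊆ S ∧ ¬U \ S ⊆ T ∧ closed T} with h𝓗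
  have h𝓗sub : ∀ T ∈ 𝓗, ∀ T' ∈ 𝓗, (T \ S).image q = (T' \ S).image q → T \ S ⊆ T' \ S := by
    intro T hT T' hT' himg x hx
    have hqx : q x ∈ (T' \ S).image q := himg ▸ mem_image_of_mem q hx
    obtain ⟨e, he, hex⟩ := mem_image.1 hqx
    rw [mem_sdiff] at he hx ⊢
    rw [mem_filter] at hT hT'
    exact ⟨hT'.2.2.2 e (h.subset T' hT'.1 he.1) x (h.subset T hT.1 hx.1) hex he.2 he.1, hx.2⟩
  have h𝓗c : #𝓗 ≤ α * (#S + 1) * 2 ^ k := by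
    have hpow : #(univ.image q).powerset ≤ 2 ^ k := by
      rw [card_powerset]
      exact Nat.pow_le_pow_right (by norm_num) hq
    refine le_trans (card_le_mul_card_image_of_maps_to (f := fun T => (T \ S).image q)
      (t := (univ.image q).powerset)
      (fun T _ => mem_powerset.2 (image_subset_image (subset_univ _))) (α * (#S + 1)) ?_)
      (Nat.mul_le_mul_left _ hpow)
    intro D _
    rcases ({T ∈ 𝓗 | (T \ S).image q = D} : Finset (Finset V)).eq_empty_or_nonempty with h0 | ⟨T₀, hT₀⟩
    · simp [h0]
    rw [mem_filter] at hT₀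
    have hsd : ∀ T ∈ ({T ∈ 𝓗 | (T \ S).image q = D} : Finset (Finset V)), T \ S = T₀ \ S := by
      intro T hT
      rw [mem_filter] at hT
      have himg := hT.2.trans hT₀.2.symm
      exact Subset.antisymm (h𝓗sub T hT.1 T₀ hT₀.1 himg) (h𝓗sub T₀ hT₀.1 T hT.1 himg.symm)
    have hT₀' := (mem_filter.1 hT₀.1).2
    obtain ⟨e, he, heS⟩ := not_subset.1 hT₀'.1
    obtain ⟨e', he', heT'⟩ := not_subset.1 hT₀'.2.1
    rw [mem_sdiff] at he'
    have := h.card_le_of_card_mem (h.subset T₀ (mem_filter.1 hT₀.1).1 he) he'.1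
      (𝒢 := {T ∈ 𝓗 | (T \ S).image q = D}) ((filter_subset _ _).trans (filter_subset _ _)) ?_ ?_
      (R := Icc #(T₀ \ S) (#(T₀ \ S) + #S)) ?_
    · rw [Nat.card_Icc] at this
      refine this.trans (le_of_eq ?_)
      congr 1
      omega
    · intro T hT
      have : e ∈ T \ S := by rw [hsd T hT]; exact mem_sdiff.2 ⟨he, heS⟩
      exact (mem_sdiff.1 this).1
    · intro T hT hcon
      have : e' ∈ T₀ \ S := by rw [← hsd T hT]; exact mem_sdiff.2 ⟨hcon, he'.2⟩
      exact heT' (mem_sdiff.1 this).1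
    · intro T hT
      have h1 := card_sdiff_add_card_inter T S
      have h2 : #(T ∩ S) ≤ #S := card_le_card inter_subset_right
      rw [hsd T hT] at h1
      rw [mem_Icc]
      omega
  have hA1 : ∀ y ∈ S, #{T ∈ 𝓕 | y ∈ T ∧ T ⊆ S} ≤ α * (2 * k) + 1 := by
    intro y hy
    have hsub : ({T ∈ 𝓕 | y ∈ T ∧ T ⊆ S} : Finset (Finset V)) ⊆
        insert S {T ∈ 𝓕 | y ∈ T ∧ T ⊆ S ∧ #T < 2 * k} := by
      intro T hT
      rw [mem_filter] at hT
      rw [mem_insert, mem_filter]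
      by_cases hlt : #T < 2 * k
      · exact Or.inr ⟨hT.1, hT.2.1, hT.2.2, hlt⟩
      · left
        refine eq_of_subset_of_card_le hT.2.2 (hmin T hT.1 (not_lt.1 hlt) (hS2.trans ?_))
        exact card_le_card (sdiff_subset_sdiff Subset.rfl hT.2.2)
    refine (card_le_card hsub).trans ((card_insert_le _ _).trans (Nat.add_le_add_right ?_ 1))
    have := h.card_le_of_card_mem (hSU hy) hv.1
      (𝒢 := {T ∈ 𝓕 | y ∈ T ∧ T ⊆ S ∧ #T < 2 * k}) (filter_subset _ _)
      (fun X hX => (mem_filter.1 hX).2.1) (fun X hX hcon => hv.2 ((mem_filter.1 hX).2.2.1 hcon))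
      (R := range (2 * k)) (fun X hX => mem_range.2 (mem_filter.1 hX).2.2.2)
    rwa [card_range] at this
  have hA2 : ∀ y ∈ S, #{T ∈ 𝓕 | y ∈ T ∧ T.erase y ∈ 𝓕 ∧ U \ S ⊆ T} ≤ α * (2 * k) + 1 := by
    intro y hy
    refine le_trans ?_ (hA1 y hy)
    refine card_le_card_of_injOn (fun T => U \ T.erase y) ?_ ?_
    · intro T hT
      rw [mem_coe, mem_filter] at hT ⊢
      refine ⟨h.compl _ hT.2.2.1, by simp [hSU hy], fun x hx => ?_⟩
      rw [mem_sdiff, mem_erase] at hx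
      by_contra hxS
      exact hx.2 ⟨fun hxy => hxS (hxy ▸ hy), hT.2.2.2 (mem_sdiff.2 ⟨hx.1, hxS⟩)⟩
    · intro A hA B hB hAB
      rw [mem_coe, mem_filter] at hA hB
      dsimp only at hAB
      rw [← insert_erase hA.2.1, ← insert_erase hB.2.1,
        ← Finset.sdiff_sdiff_eq_self (h.subset _ hA.2.2.1), hAB,
        Finset.sdiff_sdiff_eq_self (h.subset _ hB.2.2.1)]
  have hA3 : ∑ y ∈ G, #{T ∈ 𝓗 | y ∈ T ∧ T.erase y ∈ 𝓕} ≤ #𝓗 * α := by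
    have hswap : ∑ y ∈ G, #{T ∈ 𝓗 | y ∈ T ∧ T.erase y ∈ 𝓕} =
        ∑ T ∈ 𝓗, #{y ∈ G | y ∈ T ∧ T.erase y ∈ 𝓕} := by
      simp only [card_filter]
      exact sum_comm
    rw [hswap]
    refine sum_le_card_nsmul _ _ _ fun T hT => ?_
    rw [mem_filter] at hT
    obtain ⟨e, he, heS⟩ := not_subset.1 hT.2.1
    obtain ⟨e', he', heT'⟩ := not_subset.1 hT.2.2.1
    rw [mem_sdiff] at he'
    have hinj : Set.InjOn (fun y => T.erase y) ({y ∈ G | y ∈ T ∧ T.erase y ∈ 𝓕} : Finset V) := by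
      intro a ha b hb hab
      rw [mem_coe, mem_filter] at ha hb
      exact erase_injOn T (mem_coe.2 ha.2.1) (mem_coe.2 hb.2.1) hab
    rw [← card_image_of_injOn hinj]
    have := h.card_le_of_card_mem (h.subset T hT.1 he) he'.1
      (𝒢 := ({y ∈ G | y ∈ T ∧ T.erase y ∈ 𝓕} : Finset V).image fun y => T.erase y)
      ?_ ?_ ?_ (R := {#T - 1}) ?_
    · simpa using this
    all_goals
      intro X hX
      obtain ⟨y, hy, rfl⟩ := mem_image.1 hX
      rw [mem_filter] at hy
    · exact hy.2.2
    · refine mem_erase.2 ⟨fun hey => heS (hey ▸ (mem_filter.1 hy.1).1), he⟩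
    · exact fun hcon => heT' (mem_of_mem_erase hcon)
    · rw [card_erase_of_mem hy.2.1]
      exact mem_singleton_self _
  have hcover : ∀ y ∈ G, coll 𝓕 y ≤ 2 * (α * (2 * k) + 1) + #{T ∈ 𝓗 | y ∈ T ∧ T.erase y ∈ 𝓕} := by
    intro y hy
    obtain ⟨hyS, x₀, hx₀, hqx, hxy⟩ := mem_filter.1 hy
    have hsub : ({T ∈ 𝓕 | y ∈ T ∧ T.erase y ∈ 𝓕} : Finset (Finset V)) ⊆
        ({T ∈ 𝓕 | y ∈ T ∧ T ⊆ S} ∪ {T ∈ 𝓕 | y ∈ T ∧ T.erase y ∈ 𝓕 ∧ U \ S ⊆ T}) ∪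
          {T ∈ 𝓗 | y ∈ T ∧ T.erase y ∈ 𝓕} := by
      intro T hT
      rw [mem_filter] at hT
      rw [mem_union, mem_union, mem_filter, mem_filter, mem_filter]
      by_cases c1 : T ⊆ S
      · exact Or.inl (Or.inl ⟨hT.1, hT.2.1, c1⟩)
      by_cases c2 : U \ S ⊆ T
      · exact Or.inl (Or.inr ⟨hT.1, hT.2.1, hT.2.2, c2⟩)
      refine Or.inr ⟨mem_filter.2 ⟨hT.1, c1, c2, ?_⟩, hT.2⟩
      intro x hx x' hx' hxx' hxS hxT
      by_contra hxT'
      have hxS' : x' ∉ S := fun hcon => hxS ((hqS x hx x' hx' hxx').2 hcon)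
      have hne : q x ≠ q y := fun hcon => hxS ((hqS x hx y (hSU hyS) hcon).2 hyS)
      have hx1 : x ≠ y := fun hcon => hxS (hcon ▸ hyS)
      have hx2 : x' ≠ y := fun hcon => hxS' (hcon ▸ hyS)
      have t1 := hqT T hT.1 x hx x' hx' y (hSU hyS) x₀ hx₀ hxx' hqx.symm hne
        (fun hcon => hxT' (hcon.1 hxT))
      have t2 := hqT _ hT.2.2 x hx x' hx' y (hSU hyS) x₀ hx₀ hxx' hqx.symm hne
        (fun hcon => hxT' (mem_of_mem_erase (hcon.1 (mem_erase.2 ⟨hx1, hxT⟩))))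
      have t3 := t2.2 (mem_erase.2 ⟨hxy, t1.1 hT.2.1⟩)
      exact notMem_erase y T t3
    have t1 := card_le_card hsub
    have t2 := card_union_le ({T ∈ 𝓕 | y ∈ T ∧ T ⊆ S} ∪
      {T ∈ 𝓕 | y ∈ T ∧ T.erase y ∈ 𝓕 ∧ U \ S ⊆ T}) {T ∈ 𝓗 | y ∈ T ∧ T.erase y ∈ 𝓕}
    have t3 := card_union_le {T ∈ 𝓕 | y ∈ T ∧ T ⊆ S}
      {T ∈ 𝓕 | y ∈ T ∧ T.erase y ∈ 𝓕 ∧ U \ S ⊆ T}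
    have t4 := hA1 y hyS
    have t5 := hA2 y hyS
    unfold coll
    omega
  by_contra! hcon
  have hlow : #G * (4 * 2 ^ k * α * α + 2 * (α * (2 * k) + 1) + 1) ≤ ∑ y ∈ G, coll 𝓕 y := by
    rw [← smul_eq_mul]
    exact card_nsmul_le_sum G _ _ fun y hy => hcon y (mem_filter.1 hy).1
  have hup : ∑ y ∈ G, coll 𝓕 y ≤ #G * (2 * (α * (2 * k) + 1)) + #𝓗 * α := by
    refine (sum_le_sum hcover).trans ?_
    rw [sum_add_distrib, sum_const, smul_eq_mul]
    exact Nat.add_le_add_left hA3 _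
  have hfin : #𝓗 * α ≤ #G * (4 * 2 ^ k * α * α) := by
    have : #S + 1 ≤ 4 * #G := by omega
    calc #𝓗 * α ≤ α * (#S + 1) * 2 ^ k * α := Nat.mul_le_mul_right _ h𝓗c
      _ ≤ α * (4 * #G) * 2 ^ k * α := by gcongr
      _ = #G * (4 * 2 ^ k * α * α) := by ring
  have hGpos : 0 < #G := by omega
  nlinarith

/-- The constant in the linear bound on trace families. -/
def traceConst (α k : ℕ) : ℕ :=
  4 * 2 ^ k * α * α + 2 * (α * (2 * k) + 1) + 2 * (2 * k * (α * (2 * k)) + 1) + 2 ^ (2 * k)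

/-- Trace families have linear size. -/
lemma card_le (h : TraceFamily α k U 𝓕) (hk : 1 ≤ k) : #𝓕 ≤ traceConst α k * (#U + 1) := by
  induction hn : #U generalizing U 𝓕 with
  | zero =>
    have : 𝓕 ⊆ U.powerset := fun T hT => mem_powerset.2 (h.subset T hT)
    have := card_le_card this
    rw [card_powerset, hn] at this
    have h1 : 2 ^ (2 * k) ≤ traceConst α k := Nat.le_add_left _ _
    have h2 : 1 ≤ 2 ^ (2 * k) := Nat.one_le_two_pow
    omega
  | succ n ih =>
    by_cases hU : #U < 2 * k
    · have : 𝓕 ⊆ U.powerset := fun T hT => mem_powerset.2 (h.subset T hT)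
      have := card_le_card this
      rw [card_powerset] at this
      have h2 : 2 ^ #U ≤ 2 ^ (2 * k) := Nat.pow_le_pow_right (by norm_num) hU.le
      have h3 : 2 ^ (2 * k) ≤ traceConst α k := Nat.le_add_left _ _
      nlinarith
    by_cases hsmall : ∀ S ∈ 𝓕, #S < 2 * k ∨ #(U \ S) < 2 * k
    · have h1 := h.card_le_of_small (not_lt.1 hU) hsmall
      rw [hn] at h1
      have h3 : 2 * (2 * k * (α * (2 * k)) + 1) ≤ traceConst α k :=
        (Nat.le_add_left _ _).trans (Nat.le_add_right _ _)
      nlinarith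
    · push Not at hsmall
      obtain ⟨S₀, hS₀⟩ := hsmall
      obtain ⟨S, hS, hmin⟩ := exists_min_image
        ({S ∈ 𝓕 | 2 * k ≤ #S ∧ 2 * k ≤ #(U \ S)} : Finset (Finset V)) card ⟨S₀, mem_filter.2 hS₀⟩
      rw [mem_filter] at hS
      obtain ⟨y, hy, hcoll⟩ := h.exists_coll_le hk hS.1 hS.2.1 hS.2.2
        fun T hT h1 h2 => hmin T (mem_filter.2 ⟨hT, h1, h2⟩)
      have h1 := ih (h.erase y) (by rw [card_erase_of_mem (h.subset S hS.1 hy), hn]; rfl)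
      have h2 := card_le_card_image_erase_add 𝓕 y
      have h3 : 4 * 2 ^ k * α * α + 2 * (α * (2 * k) + 1) ≤ traceConst α k :=
        (Nat.le_add_right _ _).trans (Nat.le_add_right _ _)
      nlinarith

end TraceFamily

end Trace

lemma chainBound_mono {m m' L L' : ℕ} (hm : m ≤ m') (hL : L ≤ L') :
    chainBound m L ≤ chainBound m' L' := by
  induction L' generalizing L with
  | zero =>
    obtain rfl : L = 0 := by omega
    exact le_rfl
  | succ L' ih =>
    cases L with
    | zero => exact chainBound_pos m' (L' + 1)
    | succ L =>
      have := ih (L := L) (by omega)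
      simp only [chainBound]
      gcongr

lemma TraceFamily.traceConst_mono {α α' k k' : ℕ} (hα : α ≤ α') (hk : k ≤ k') :
    traceConst α k ≤ traceConst α' k' := by
  have h1 : 2 ^ k ≤ 2 ^ k' := Nat.pow_le_pow_right (by norm_num) hk
  have h2 : 2 ^ (2 * k) ≤ 2 ^ (2 * k') := Nat.pow_le_pow_right (by norm_num) (by omega)
  unfold traceConst
  gcongr

/-- The constant in the count of small sets of a graph without light cuts. -/
def baseConst (k : ℕ) : ℕ :=
  TraceFamily.traceConst (chainBound (2 * (k - 1)) (k - 2)) k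

lemma baseConst_mono {k k' : ℕ} (hk : 2 ≤ k) (hkk : k ≤ k') : baseConst k ≤ baseConst k' :=
  TraceFamily.traceConst_mono (chainBound_mono (by omega) (by omega)) hkk

/-- The constant in the count of small sets. -/
def smallConst (k : ℕ) : ℕ := 2 ^ k * (2 * baseConst k + 1)

section Count

variable {V : Type*} [Fintype V] [DecidableEq V] {w : V → V → ℝ} {θ : ℝ} {k : ℕ}

open Classical in
/-- The nonempty proper subsets separating weight less than `2 θ` (each pair counted twice). -/
noncomputable def smallSets (w : V → V → ℝ) (θ : ℝ) : Finset (Finset V) :=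
  {X | X.Nonempty ∧ X ≠ univ ∧ cut w X < 2 * θ}

lemma mem_smallSets {X : Finset V} :
    X ∈ smallSets w θ ↔ X.Nonempty ∧ X ≠ univ ∧ cut w X < 2 * θ := by
  simp [smallSets]

lemma traceFamily_smallSets (hw : ∀ x y, 0 ≤ w x y) (hk : 2 ≤ k)
    (h1 : ∀ X : Finset V, X.Nonempty → X ≠ univ → θ < cut w X)
    (h2 : ∀ f : V → ℕ, #(univ.image f) = k → (k : ℝ) * θ ≤ colorCost w f) :
    TraceFamily (chainBound (2 * (k - 1)) (k - 2)) k univ (smallSets w θ) where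
  subset T _ := subset_univ T
  compl T hT := by
    rw [mem_smallSets] at hT ⊢
    rw [← compl_eq_univ_sdiff, cut_compl]
    refine ⟨?_, ?_, hT.2.2⟩
    · rw [nonempty_iff_ne_empty, ne_eq, compl_eq_empty_iff]
      exact hT.2.1
    · rw [ne_eq, compl_eq_univ_iff, ← ne_eq, ← nonempty_iff_ne_empty]
      exact hT.1
  width u _ v _ 𝒜 h𝒜 hanti hu hv :=
    (card_antichain_lt hw hk h1 h2 hanti (fun X hX => (mem_smallSets.1 (h𝒜 hX)).2.2) hu hv).le
  refine S hS := by
    rw [mem_smallSets] at hS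
    obtain ⟨q, hq, hqS, hqT⟩ := exists_refining_coloring hw hk h2 hS.2.2 hS.1 hS.2.1
    exact ⟨q, hq, fun x _ y _ => hqS x y, fun T hT x _ y _ x' _ y' _ =>
      hqT T (mem_smallSets.1 hT).2.2 x y x' y'⟩

omit [DecidableEq V] in
lemma cost_subtype (p : V → Prop) [DecidablePred p] (R : V → V → Prop) :
    cost (fun a b : {x // p x} => w a b) (fun a b => R a b) =
      cost w fun x y => p x ∧ p y ∧ R x y := by
  classical
  unfold cost
  rw [← sum_subtype (univ.filter p) (by simp)
    (fun x => ∑ b : {x // p x}, if R x b then w x b else 0), sum_filter]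
  refine sum_congr rfl fun x _ => ?_
  rw [← sum_subtype (univ.filter p) (by simp) (fun y => if R x y then w x y else 0), sum_filter]
  by_cases hx : p x
  · rw [if_pos hx]
    refine sum_congr rfl fun y _ => ?_
    by_cases hy : p y <;> by_cases hR : R x y <;> simp [hx, hy, hR]
  · simp [hx]

omit [DecidableEq V] in
lemma cut_subtype (Q : V → ℕ) (i : ℕ) (X : Finset V) :
    cut (fun a b : {x // Q x = i} => w a b) (X.subtype (Q · = i)) = innerCost w Q i X := by
  unfold cut innerCost
  rw [← cost_subtype]
  exact cost_congr fun x y => by simp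

omit [DecidableEq V] in
/-- Refining one class of a colouring by a colouring of that class. -/
lemma le_colorCost_subtype
    (h2 : ∀ f : V → ℕ, #(univ.image f) = k → (k : ℝ) * θ ≤ colorCost w f)
    {Q : V → ℕ} {p : ℕ} (hp : p < k) (hQ : #(univ.image Q) = p) (hcost : colorCost w Q ≤ (p - 1) * θ)
    {i : ℕ} (hi : i ∈ univ.image Q) (f : {x // Q x = i} → ℕ) (hf : #(univ.image f) = k - p + 1) :
    ((k - p + 1 : ℕ) : ℝ) * θ ≤ colorCost (fun a b : {x // Q x = i} => w a b) f := by
  have hcard : #(univ.image Q) ≠ 0 := by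
    rw [ne_eq, card_eq_zero]
    exact ne_empty_of_mem hi
  set f' : V → ℕ := fun x => if h : Q x = i then f ⟨x, h⟩ else 0 with hf'
  have hf'x : ∀ x : {x // Q x = i}, f' x = f x := fun x => by simp [hf', x.2]
  set g : V → ℕ ⊕ ℕ := fun x => if Q x = i then Sum.inl (f' x) else Sum.inr (Q x) with hg
  have him : univ.image g = (univ.image f).disjSum ((univ.image Q).erase i) := by
    ext b
    simp only [mem_image, mem_univ, true_and, mem_disjSum, mem_erase]
    constructor
    · rintro ⟨x, rfl⟩
      by_cases hx : Q x = i
      · left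
        exact ⟨f' x, ⟨⟨x, hx⟩, (hf'x ⟨x, hx⟩).symm⟩, by simp [hg, hx]⟩
      · right
        exact ⟨Q x, ⟨hx, x, rfl⟩, by simp [hg, hx]⟩
    · rintro (⟨_, ⟨x, rfl⟩, rfl⟩ | ⟨_, ⟨hne, x, rfl⟩, rfl⟩)
      · exact ⟨x, by simp [hg, x.2, hf'x]⟩
      · exact ⟨x, by simp [hg, hne]⟩
  have hgk : #(univ.image g) = k := by
    rw [him, card_disjSum, hf, card_erase_of_mem hi, hQ]
    omega
  have hle := le_colorCost h2 g hgk
  have hsplit : colorCost w g = colorCost w Q +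
      colorCost (fun a b : {x // Q x = i} => w a b) f := by
    have : colorCost (fun a b : {x // Q x = i} => w a b) f =
        cost w fun x y => Q x = i ∧ Q y = i ∧ f' x ≠ f' y := by
      rw [← cost_subtype]
      exact cost_congr fun x y => by rw [hf'x, hf'x]
    rw [this]
    refine cost_or (fun x y => ?_) fun x y h h' => h (h'.1.trans h'.2.1.symm)
    simp only [hg, ne_eq]
    by_cases hx : Q x = i <;> by_cases hy : Q y = i
    · simp [hx, hy]
    · simp [hx, hy, Ne.symm hy]
    · simp [hx, hy]
    · simp [hx, hy]
  rw [hsplit] at hle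
  have hc : ((k - p + 1 : ℕ) : ℝ) = k - p + 1 := by
    rw [Nat.cast_add, Nat.cast_sub hp.le, Nat.cast_one]
  rw [hc]
  linarith

omit [DecidableEq V] in
/-- A colouring with fewer than `k` classes, small cost, and no light cut inside a class. -/
lemma exists_maximal_light_coloring [Nonempty V] (hθ : 0 < θ) (hk : 2 ≤ k)
    (h2 : ∀ f : V → ℕ, #(univ.image f) = k → (k : ℝ) * θ ≤ colorCost w f) :
    ∃ Q : V → ℕ, #(univ.image Q) < k ∧ colorCost w Q ≤ (#(univ.image Q) - 1) * θ ∧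
      ∀ (x y : V) (X : Finset V), Q x = Q y → x ∈ X → y ∉ X → θ < innerCost w Q (Q x) X := by
  classical
  set Pr : ℕ → Prop := fun p => ∃ Q : V → ℕ, #(univ.image Q) = p ∧ colorCost w Q ≤ (p - 1) * θ
    with hPr
  have h1 : Pr 1 := by
    refine ⟨fun _ => 0, ?_, ?_⟩
    · rw [image_const univ_nonempty, card_singleton]
    · simp [colorCost, cost]
  obtain ⟨Q, hQ, hcost⟩ : Pr (Nat.findGreatest Pr k) := Nat.findGreatest_spec (by omega) h1
  have hle := Nat.findGreatest_le (P := Pr) k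
  have hgr : ∀ p, Nat.findGreatest Pr k < p → p ≤ k → ¬Pr p :=
    fun p hp hpk => Nat.findGreatest_is_greatest hp hpk
  set p := Nat.findGreatest Pr k with hp
  have hpk : p < k := by
    refine lt_of_le_of_ne hle fun h => ?_
    rw [h] at hQ hcost
    have := h2 Q hQ
    linarith
  refine ⟨Q, by omega, by rwa [hQ], fun x y X hxy hx hy => ?_⟩
  by_contra! hcon
  obtain ⟨Q', hQ', hcost', -⟩ := exists_split (w := w) Q rfl hx hxy.symm hy
  refine hgr (p + 1) (Nat.lt_succ_self p) hpk ⟨Q', by omega, ?_⟩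
  push_cast
  linarith

/-- There are linearly many small sets. -/
theorem card_smallSets_le [Nonempty V] (hw : ∀ x y, 0 ≤ w x y) (hθ : 0 < θ) (hk : 2 ≤ k)
    (h2 : ∀ f : V → ℕ, #(univ.image f) = k → (k : ℝ) * θ ≤ colorCost w f) :
    #(smallSets w θ) ≤ smallConst k * Fintype.card V := by
  classical
  obtain ⟨Q, hQk, hcost, hlight⟩ := exists_maximal_light_coloring hθ hk h2
  have hlight' : ∀ (x y : V) (X : Finset V), Q x = Q y → ¬(x ∈ X ↔ y ∈ X) →
      θ < innerCost w Q (Q x) X := by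
    intro x y X hxy hne
    by_cases hx : x ∈ X
    · exact hlight x y X hxy hx (by tauto)
    · rw [hxy]
      exact hlight y x X hxy.symm (by tauto) hx
  set colors := univ.image Q with hcolors
  have hpow : #colors.powerset ≤ 2 ^ k := by
    rw [card_powerset]
    exact Nat.pow_le_pow_right (by norm_num) hQk.le
  set splits : ℕ → Finset V → Prop := fun i X => ∃ x y, Q x = i ∧ Q y = i ∧ ¬(x ∈ X ↔ y ∈ X)
    with hsplits
  have huniq : ∀ X ∈ smallSets w θ, ∀ i j, splits i X → splits j X → i = j := by
    rintro X hX i j ⟨x, y, rfl, hxy, hne⟩ ⟨x', y', rfl, hxy', hne'⟩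
    by_contra hij
    have t1 := hlight' x y X hxy.symm hne
    have t2 := hlight' x' y' X hxy'.symm hne'
    have t3 := innerCost_add_le hw Q hij X
    have t4 := (mem_smallSets.1 hX).2.2
    linarith
  have hdet : ∀ X Y : Finset V, X.image Q = Y.image Q → ∀ x, ¬splits (Q x) X → ¬splits (Q x) Y →
      x ∈ X → x ∈ Y := by
    intro X Y himg x hX hY hx
    have hqx : Q x ∈ Y.image Q := himg ▸ mem_image_of_mem Q hx
    obtain ⟨e, he, hex⟩ := mem_image.1 hqx
    by_contra hxY
    exact hY ⟨e, x, hex, rfl, by tauto⟩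
  have hclass : ∀ i ∈ colors, #{X ∈ smallSets w θ | splits i X} ≤
      2 ^ k * (baseConst k * (Fintype.card {x // Q x = i} + 1)) := by
    intro i hi
    set w' : {x // Q x = i} → {x // Q x = i} → ℝ := fun a b => w a b with hw'
    have hpos : 0 < #colors := card_pos.2 ⟨i, hi⟩
    have hfam := traceFamily_smallSets (w := w') (θ := θ) (k := k - #colors + 1)
      (fun x y => hw x y) (by omega) ?_
      (fun f hf => le_colorCost_subtype h2 hQk rfl hcost hi f hf)
    · have hc := hfam.card_le (by omega)
      rw [card_univ] at hc
      have hc' : #(smallSets w' θ) ≤ baseConst k * (Fintype.card {x // Q x = i} + 1) :=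
        hc.trans (Nat.mul_le_mul_right _ (baseConst_mono (by omega) (by omega)))
      refine le_trans ?_ (Nat.mul_le_mul hpow hc')
      rw [← card_product]
      refine card_le_card_of_injOn (fun X => (X.image Q, X.subtype (Q · = i))) ?_ ?_
      · intro X hX
        rw [mem_coe, mem_filter] at hX
        rw [mem_coe, mem_product, mem_powerset, mem_smallSets]
        refine ⟨image_subset_image (subset_univ _), ?_, ?_, ?_⟩
        · obtain ⟨x, y, hx, hy, hne⟩ := hX.2
          by_cases hxX : x ∈ X
          · exact ⟨⟨x, hx⟩, by simpa using hxX⟩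
          · exact ⟨⟨y, hy⟩, by rw [mem_subtype]; tauto⟩
        · obtain ⟨x, y, hx, hy, hne⟩ := hX.2
          intro huniv
          rw [eq_univ_iff_forall] at huniv
          have h1 := huniv ⟨x, hx⟩
          have h2 := huniv ⟨y, hy⟩
          rw [mem_subtype] at h1 h2
          tauto
        · dsimp only
          rw [hw', cut_subtype]
          exact (innerCost_le_cut hw Q i X).trans_lt (mem_smallSets.1 hX.1).2.2
      · have key : ∀ X Y : Finset V, X ∈ smallSets w θ → Y ∈ smallSets w θ → splits i X →
            splits i Y → X.image Q = Y.image Q → X.subtype (Q · = i) = Y.subtype (Q · = i) →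
            X ⊆ Y := by
          intro X Y hX hY hsX hsY h1 h2 x hx
          by_cases hxi : Q x = i
          · have : (⟨x, hxi⟩ : {x // Q x = i}) ∈ Y.subtype (Q · = i) := by
              rw [← h2, mem_subtype]
              exact hx
            exact mem_subtype.1 this
          · exact hdet X Y h1 x (fun h => hxi (huniq X hX _ _ h hsX))
              (fun h => hxi (huniq Y hY _ _ h hsY)) hx
        intro X hX Y hY hXY
        rw [mem_coe, mem_filter] at hX hY
        rw [Prod.mk.injEq] at hXY
        exact Subset.antisymm (key X Y hX.1 hY.1 hX.2 hY.2 hXY.1 hXY.2)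
          (key Y X hY.1 hX.1 hY.2 hX.2 hXY.1.symm hXY.2.symm)
    · intro X hne huniv
      obtain ⟨x, hx⟩ := hne
      obtain ⟨y, hy⟩ : ∃ y, y ∉ X := by
        by_contra! h
        exact huniv (eq_univ_iff_forall.2 h)
      have := hlight x y (X.map (Function.Embedding.subtype _)) (x.2.trans y.2.symm)
        (by simp [hx, x.2]) (by simp [hy])
      rw [x.2, ← cut_subtype] at this
      convert this using 2
      ext a
      simp [a.2]
  have hunsplit : #{X ∈ smallSets w θ | ∀ i, ¬splits i X} ≤ 2 ^ k := by
    refine le_trans ?_ hpow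
    refine card_le_card_of_injOn (fun X => X.image Q)
      (fun X _ => mem_coe.2 (mem_powerset.2 (image_subset_image (subset_univ _)))) ?_
    intro X hX Y hY hXY
    rw [mem_coe, mem_filter] at hX hY
    exact Subset.antisymm (fun x hx => hdet X Y hXY x (hX.2 _) (hY.2 _) hx)
      (fun x hx => hdet Y X hXY.symm x (hY.2 _) (hX.2 _) hx)
  have hcover : smallSets w θ ⊆ {X ∈ smallSets w θ | ∀ i, ¬splits i X} ∪
      colors.biUnion fun i => {X ∈ smallSets w θ | splits i X} := by
    intro X hX
    rw [mem_union, mem_biUnion]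
    by_cases h : ∀ i, ¬splits i X
    · exact Or.inl (mem_filter.2 ⟨hX, h⟩)
    · push Not at h
      obtain ⟨i, hi⟩ := h
      have hi' := hi
      obtain ⟨x, y, rfl, -⟩ := hi'
      exact Or.inr ⟨Q x, mem_image_of_mem Q (mem_univ x), mem_filter.2 ⟨hX, hi⟩⟩
  have hsum : ∑ i ∈ colors, Fintype.card {x // Q x = i} = Fintype.card V := by
    rw [← card_univ, card_eq_sum_card_image Q univ]
    exact sum_congr rfl fun i _ => Fintype.card_subtype _
  have hcolV : #colors ≤ Fintype.card V := card_image_le.trans card_univ.le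
  have hVpos : 1 ≤ Fintype.card V := Fintype.card_pos
  calc #(smallSets w θ)
      ≤ 2 ^ k + ∑ i ∈ colors, 2 ^ k * (baseConst k * (Fintype.card {x // Q x = i} + 1)) :=
        (card_le_card hcover).trans ((card_union_le _ _).trans (Nat.add_le_add hunsplit
          (card_biUnion_le.trans (sum_le_sum hclass))))
    _ = 2 ^ k * 1 + 2 ^ k * (baseConst k * (Fintype.card V + #colors)) := by
        rw [← mul_sum, ← mul_sum, sum_add_distrib, hsum, sum_const, smul_eq_mul, mul_one, mul_one]
    _ ≤ 2 ^ k * Fintype.card V + 2 ^ k * (baseConst k * (Fintype.card V + Fintype.card V)) := by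
        gcongr
    _ = smallConst k * Fintype.card V := by
        unfold smallConst
        ring

end Count

lemma inv_pow_mul_le_inv_pow {A B : ℝ} (hA : 0 < A) (hB : 0 < B) (k : ℕ) :
    (A ^ k)⁻¹ * (1 + k * ((A - B) / A)) ≤ (B ^ k)⁻¹ := by
  have h1 : 1 + (k : ℝ) * (A / B - 1) ≤ (1 + (A / B - 1)) ^ k := by
    refine one_add_mul_le_pow ?_ k
    have : 0 < A / B := div_pos hA hB
    linarith
  have h2 : (A - B) / A ≤ A / B - 1 := by
    rw [div_sub_one hB.ne', div_le_div_iff₀ hA hB]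
    nlinarith [sq_nonneg (A - B)]
  have h3 : (B ^ k)⁻¹ = (A ^ k)⁻¹ * (1 + (A / B - 1)) ^ k := by
    rw [add_sub_cancel, div_pow]
    field_simp
  rw [h3]
  refine mul_le_mul_of_nonneg_left (le_trans ?_ h1) (by positivity)
  gcongr

section Contract

variable {V : Type*} [Fintype V] [DecidableEq V] {w : V → V → ℝ} {θ : ℝ} {k : ℕ}

/-- A colouring by its own colour classes. -/
def IsCanonical (c : V → Finset V) : Prop := ∀ x y, y ∈ c x ↔ c y = c x

omit [Fintype V] [DecidableEq V] in
lemma IsCanonical.eq_of_kernel {c d : V → Finset V} (hc : IsCanonical c) (hd : IsCanonical d)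
    (h : ∀ x y, c x = c y ↔ d x = d y) : c = d := by
  ext x y
  rw [hc, hd, h]

/-- `f` is constant on the colour classes of `P`. -/
def Compat {β γ : Type*} (P : V → β) (f : V → γ) : Prop := ∀ x y, P x = P y → f x = f y

open Classical in
/-- The minimum `k`-cuts, as canonical colourings. -/
noncomputable def minCuts (w : V → V → ℝ) (k : ℕ) (θ : ℝ) : Finset (V → Finset V) :=
  {c | IsCanonical c ∧ #(univ.image c) = k ∧ colorCost w c = k * θ}

lemma mem_minCuts {c : V → Finset V} :
    c ∈ minCuts w k θ ↔ IsCanonical c ∧ #(univ.image c) = k ∧ colorCost w c = k * θ := by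
  simp [minCuts]

/-- The weight separated by `S` inside the classes of `c`. -/
noncomputable def restCost (w : V → V → ℝ) (c : V → Finset V) (S : Finset V) : ℝ :=
  cost w fun x y => c x = c y ∧ ¬(x ∈ S ↔ y ∈ S)

open Classical in
/-- The small sets of `P`-classes of which `c` does not cut too much. -/
noncomputable def richSets (w : V → V → ℝ) (k : ℕ) (θ : ℝ) (c : V → Finset V) (P : V → V) :
    Finset (Finset V) :=
  {S ∈ smallSets w θ | θ * (1 + 1 / (2 * k)) ≤ restCost w c S ∧ Compat P (· ∈ S)}

/-- The number of classes that are never contracted. -/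
def rank (k : ℕ) : ℕ := 4 * k ^ 2 + 2 * k

/-- The potential of the cut `c` after contracting the classes of `P`. -/
noncomputable def potential (w : V → V → ℝ) (k : ℕ) (θ : ℝ) (c : V → Finset V) (P : V → V) : ℝ :=
  #(univ.image P) - rank k + 2 * k * #(richSets w k θ c P)

/-- Merging the colour classes of `x` and `y`. -/
def merge (P : V → V) (x y : V) : V → V := fun z => if P z = P y then P x else P z

omit [Fintype V] in
lemma compat_merge_iff {γ : Type*} {P : V → V} {f : V → γ} {x y : V} :
    Compat (merge P x y) f ↔ Compat P f ∧ f x = f y := by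
  unfold Compat merge
  constructor
  · intro h
    refine ⟨fun a b hab => h a b (by simp [hab]), h x y ?_⟩
    by_cases hxy : P x = P y <;> simp [hxy]
  · rintro ⟨h, hxy⟩ a b hab
    by_cases ha : P a = P y <;> by_cases hb : P b = P y
    · exact h a b (ha.trans hb.symm)
    · rw [if_pos ha, if_neg hb] at hab
      rw [h a y ha, ← hxy, h x b hab]
    · rw [if_neg ha, if_pos hb] at hab
      rw [h b y hb, ← hxy, h a x hab]
    · rw [if_neg ha, if_neg hb] at hab
      exact h a b hab

lemma card_image_merge {P : V → V} {x y : V} (hxy : P x ≠ P y) :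
    #(univ.image (merge P x y)) + 1 = #(univ.image P) := by
  have : univ.image (merge P x y) = (univ.image P).erase (P y) := by
    ext a
    simp only [merge, mem_image, mem_univ, true_and, mem_erase]
    constructor
    · rintro ⟨z, rfl⟩
      by_cases hz : P z = P y
      · simp [hz, hxy]
      · simp [hz]
    · rintro ⟨ha, z, rfl⟩
      exact ⟨z, by simp [ha]⟩
  rw [this, card_erase_add_one (mem_image_of_mem P (mem_univ y))]

lemma richSets_merge {c : V → Finset V} {P : V → V} {x y : V} :
    richSets w k θ c (merge P x y) = {S ∈ richSets w k θ c P | x ∈ S ↔ y ∈ S} := by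
  ext S
  simp only [richSets, mem_filter, compat_merge_iff, eq_iff_iff]
  tauto

lemma potential_sub_merge {c : V → Finset V} {P : V → V} {x y : V} (hxy : P x ≠ P y) :
    potential w k θ c P - potential w k θ c (merge P x y) =
      1 + 2 * k * #{S ∈ richSets w k θ c P | ¬(x ∈ S ↔ y ∈ S)} := by
  have h1 : (#(univ.image (merge P x y)) : ℝ) + 1 = #(univ.image P) := by
    exact_mod_cast card_image_merge hxy
  have h2 : (#{S ∈ richSets w k θ c P | x ∈ S ↔ y ∈ S} : ℝ) +
      #{S ∈ richSets w k θ c P | ¬(x ∈ S ↔ y ∈ S)} = #(richSets w k θ c P) := by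
    exact_mod_cast card_filter_add_card_filter_not (s := richSets w k θ c P)
      (fun S => x ∈ S ↔ y ∈ S)
  unfold potential
  rw [richSets_merge, ← h1, ← h2]
  ring

lemma sum_cut_fiber {β : Type*} [DecidableEq β] (P : V → β) :
    ∑ a ∈ univ.image P, cut w {x | P x = a} = 2 * colorCost w P := by
  unfold cut colorCost
  rw [sum_cost]
  unfold cost
  rw [mul_sum]
  refine sum_congr rfl fun x _ => ?_
  rw [mul_sum]
  refine sum_congr rfl fun y _ => ?_
  have : ({a ∈ univ.image P | ¬(x ∈ ({x | P x = a} : Finset V) ↔ y ∈ ({x | P x = a} : Finset V))} :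
      Finset β) = if P x ≠ P y then {P x, P y} else ∅ := by
    ext a
    simp only [mem_filter, mem_univ, true_and]
    by_cases hxy : P x = P y
    · simp [hxy]
    · rw [if_pos hxy, mem_insert, mem_singleton]
      constructor
      · rintro ⟨-, h⟩
        by_cases hx : P x = a
        · exact Or.inl hx.symm
        · right
          tauto
      · rintro (rfl | rfl)
        · exact ⟨mem_image_of_mem P (mem_univ x), by simpa using Ne.symm hxy⟩
        · exact ⟨mem_image_of_mem P (mem_univ y), by simpa using hxy⟩
  rw [this]
  by_cases hxy : P x = P y
  · simp [hxy]
  · simp [hxy]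

/-- Few classes of `P` are small but not rich. -/
lemma card_poor_le (hw : ∀ x y, 0 ≤ w x y) (hθ : 0 < θ) (hk : 2 ≤ k)
    (h2 : ∀ f : V → ℕ, #(univ.image f) = k → (k : ℝ) * θ ≤ colorCost w f)
    {c : V → Finset V} (hc : colorCost w c = k * θ) {P : V → V} (hP : Compat P c)
    (hPk : k ≤ #(univ.image P)) {B : Finset V} (hB : B ⊆ univ.image P)
    (hB1 : ∀ a ∈ B, restCost w c {x | P x = a} < θ * (1 + 1 / (2 * k))) :
    #B + k ≤ rank k := by
  classical
  have hk0 : (2 : ℝ) ≤ k := by exact_mod_cast hk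
  set B₁ : Finset V := {a ∈ B | (k - 1) * cut w {x | P x = a} < k * θ} with hB₁
  set B₂ : Finset V := {a ∈ B | ¬(k - 1) * cut w {x | P x = a} < k * θ} with hB₂
  have hcard : #B₁ + #B₂ = #B := card_filter_add_card_filter_not _
  have h1 : #B₁ < k - 1 := by
    by_contra! hcon
    obtain ⟨J, hJ, hJc⟩ := exists_subset_card_eq hcon
    have hJP : J ⊆ univ.image P := hJ.trans ((filter_subset _ _).trans hB)
    obtain ⟨a, ha, haJ⟩ : ∃ a ∈ univ.image P, a ∉ J := by
      by_contra! h
      have := card_le_card (show univ.image P ⊆ J from h)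
      omega
    obtain ⟨u, -, rfl⟩ := mem_image.1 ha
    have hle := le_sum_cut_of_disjoint hw h2 (J := J) (by omega)
      (fun a => ({x | P x = a} : Finset V)) ?_ ?_ (u := u) ?_
    · have hlt : ∑ a ∈ J, (k - 1) * cut w {x | P x = a} < ∑ a ∈ J, (k : ℝ) * θ := by
        refine sum_lt_sum_of_nonempty (card_pos.1 (by omega)) fun a ha => ?_
        exact (mem_filter.1 (hJ ha)).2
      rw [← mul_sum, sum_const, nsmul_eq_mul, hJc, Nat.cast_sub (by omega), Nat.cast_one] at hlt
      have : (k - 1 : ℝ) * (k * θ) ≤ (k - 1) * ∑ a ∈ J, cut w {x | P x = a} :=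
        mul_le_mul_of_nonneg_left hle (by linarith)
      linarith
    · intro a ha
      obtain ⟨x, -, rfl⟩ := mem_image.1 (hJP ha)
      exact ⟨x, by simp⟩
    · intro a _ b _ x hxa hxb
      simp only [mem_filter_univ] at hxa hxb
      exact hxa.symm.trans hxb
    · intro a ha hua
      simp only [mem_filter_univ] at hua
      exact haJ (hua ▸ ha)
  have hsum : ∑ a ∈ univ.image P, (cut w {x | P x = a} - restCost w c {x | P x = a}) =
      2 * (k * θ) := by
    have hr : ∑ a ∈ univ.image P, restCost w c {x | P x = a} =
        2 * (colorCost w P - colorCost w c) := by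
      have e1 := sum_cut_fiber (w := fun x y => if c x = c y then w x y else 0) P
      have e2 : ∀ a, cut (fun x y => if c x = c y then w x y else 0) {x | P x = a} =
          restCost w c {x | P x = a} := by
        intro a
        unfold cut restCost cost
        refine sum_congr rfl fun x _ => sum_congr rfl fun y _ => ?_
        by_cases hxy : c x = c y <;> simp [hxy]
      simp only [e2] at e1
      rw [e1]
      congr 1
      have e3 : colorCost (fun x y => if c x = c y then w x y else 0) P =
          cost w fun x y => P x ≠ P y ∧ c x = c y := by
        unfold colorCost cost
        refine sum_congr rfl fun x _ => sum_congr rfl fun y _ => ?_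
        by_cases hxy : c x = c y <;> simp [hxy]
      rw [e3, eq_sub_iff_add_eq]
      refine (cost_or (fun x y => ?_) fun x y h h' => h' h.2).symm
      have := hP x y
      tauto
    rw [sum_sub_distrib, sum_cut_fiber, hr, hc]
    ring
  have hnn : ∀ S : Finset V, 0 ≤ cut w S - restCost w c S := fun S =>
    sub_nonneg.2 (cost_mono hw fun _ _ h => h.2)
  have hlow : ∀ a ∈ B₂, θ / (2 * k) ≤ cut w {x | P x = a} - restCost w c {x | P x = a} := by
    intro a ha
    obtain ⟨haB, hcut⟩ := mem_filter.1 ha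
    have hrest := hB1 a haB
    have h3 : k * θ / (k - 1) ≤ cut w {x | P x = a} := by
      rw [div_le_iff₀ (by linarith)]
      linarith
    have h4 : θ * (1 + 1 / k) ≤ k * θ / (k - 1) := by
      rw [le_div_iff₀ (by linarith)]
      have : θ * (1 + 1 / k) * (k - 1) = k * θ - θ / k := by field_simp; ring
      have : 0 < θ / k := by positivity
      linarith
    have h5 : θ * (1 + 1 / k) - θ * (1 + 1 / (2 * k)) = θ / (2 * k) := by
      field_simp
      ring
    linarith
  have h3 : (#B₂ : ℝ) * (θ / (2 * k)) ≤ 2 * (k * θ) := by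
    rw [← nsmul_eq_mul]
    refine (card_nsmul_le_sum _ _ _ hlow).trans ?_
    rw [← hsum]
    exact sum_le_sum_of_subset_of_nonneg ((filter_subset _ _).trans hB) fun a _ _ => hnn _
  have h4 : (#B₂ : ℝ) ≤ 4 * k ^ 2 := by
    rw [← mul_div_assoc, div_le_iff₀ (by linarith)] at h3
    have : (#B₂ : ℝ) * θ ≤ 4 * k ^ 2 * θ := by nlinarith
    exact le_of_mul_le_mul_right this hθ
  have h5 : #B₂ ≤ 4 * k ^ 2 := by exact_mod_cast h4
  unfold rank
  omega

end Contract

section Potential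

variable {V : Type*} [Fintype V] [DecidableEq V] {w : V → V → ℝ} {θ : ℝ} {k : ℕ}

lemma cost_ne_and_eq {c : V → Finset V} {P : V → V} (hP : Compat P c) :
    cost w (fun x y => P x ≠ P y ∧ c x = c y) = colorCost w P - colorCost w c := by
  rw [eq_sub_iff_add_eq]
  refine (cost_or (fun x y => ?_) fun x y h h' => h' h.2).symm
  have := hP x y
  tauto

lemma sub_le_colorCost (hw : ∀ x y, 0 ≤ w x y) (hθ : 0 < θ) (hk : 2 ≤ k)
    (h2 : ∀ f : V → ℕ, #(univ.image f) = k → (k : ℝ) * θ ≤ colorCost w f)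
    {c : V → Finset V} (hc : colorCost w c = k * θ) {P : V → V} (hP : Compat P c)
    (hPk : k ≤ #(univ.image P)) :
    θ * (#(univ.image P) - #(richSets w k θ c P) - rank k + k) ≤ colorCost w P := by
  classical
  set light : Finset V := {a ∈ univ.image P | cut w {x | P x = a} < 2 * θ} with hlight
  set B : Finset V := {a ∈ light | restCost w c {x | P x = a} < θ * (1 + 1 / (2 * k))} with hB
  have hBc : #B + k ≤ rank k := by
    refine card_poor_le hw hθ hk h2 hc hP hPk ((filter_subset _ _).trans (filter_subset _ _)) ?_
    exact fun a ha => (mem_filter.1 ha).2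
  have hrich : #{a ∈ light | ¬restCost w c {x | P x = a} < θ * (1 + 1 / (2 * k))} ≤
      #(richSets w k θ c P) := by
    refine card_le_card_of_injOn (fun a => ({x | P x = a} : Finset V)) ?_ ?_
    · intro a ha
      obtain ⟨hal, hr⟩ := mem_filter.1 (mem_coe.1 ha)
      obtain ⟨haP, hcut⟩ := mem_filter.1 hal
      rw [mem_coe, richSets, mem_filter, mem_smallSets]
      refine ⟨⟨?_, ?_, hcut⟩, not_lt.1 hr, ?_⟩
      · obtain ⟨x, -, rfl⟩ := mem_image.1 haP
        exact ⟨x, by simp⟩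
      · intro huniv
        rw [eq_univ_iff_forall] at huniv
        have : univ.image P ⊆ {a} := by
          intro b hb
          obtain ⟨x, -, rfl⟩ := mem_image.1 hb
          simpa using huniv x
        have := card_le_card this
        rw [card_singleton] at this
        omega
      · intro x y hxy
        simp [hxy]
    · intro a ha b _ hab
      obtain ⟨hal, -⟩ := mem_filter.1 (mem_coe.1 ha)
      obtain ⟨x, -, rfl⟩ := mem_image.1 (mem_filter.1 hal).1
      have : x ∈ ({y | P y = b} : Finset V) := by
        have hab' : ({y | P y = P x} : Finset V) = ({y | P y = b} : Finset V) := hab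
        rw [← hab']
        simp
      simpa using this
  have hlc : #B + #{a ∈ light | ¬restCost w c {x | P x = a} < θ * (1 + 1 / (2 * k))} = #light :=
    card_filter_add_card_filter_not _
  have hNc : #light + #{a ∈ univ.image P | ¬cut w {x | P x = a} < 2 * θ} = #(univ.image P) :=
    card_filter_add_card_filter_not _
  have hheavy : (#{a ∈ univ.image P | ¬cut w {x | P x = a} < 2 * θ} : ℝ) * (2 * θ) ≤
      2 * colorCost w P := by
    rw [← sum_cut_fiber, ← nsmul_eq_mul]
    refine (card_nsmul_le_sum _ (fun a => cut w {x | P x = a}) _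
      fun a ha => not_lt.1 (mem_filter.1 ha).2).trans ?_
    exact sum_le_sum_of_subset_of_nonneg (filter_subset _ _) fun a _ _ => cost_nonneg hw _
  have hcount : (#(univ.image P) : ℝ) - #(richSets w k θ c P) - rank k + k ≤
      #{a ∈ univ.image P | ¬cut w {x | P x = a} < 2 * θ} := by
    have : #(univ.image P) + k ≤ #{a ∈ univ.image P | ¬cut w {x | P x = a} < 2 * θ} +
        #(richSets w k θ c P) + rank k := by omega
    have : (#(univ.image P) : ℝ) + k ≤ #{a ∈ univ.image P | ¬cut w {x | P x = a} < 2 * θ} +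
        #(richSets w k θ c P) + rank k := by exact_mod_cast this
    linarith
  have := mul_le_mul_of_nonneg_left hcount hθ.le
  linarith

open Classical in
/-- The expected decrease of the potential under a random contraction. -/
lemma le_sum_potential_sub (hw : ∀ x y, 0 ≤ w x y) (hθ : 0 < θ) (hk : 2 ≤ k)
    (h2 : ∀ f : V → ℕ, #(univ.image f) = k → (k : ℝ) * θ ≤ colorCost w f)
    {c : V → Finset V} (hc : colorCost w c = k * θ) {P : V → V} (hP : Compat P c)
    (hPk : k ≤ #(univ.image P)) :
    θ * potential w k θ c P ≤ ∑ x, ∑ y, if P x ≠ P y ∧ c x = c y then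
      w x y * (potential w k θ c P - potential w k θ c (merge P x y)) else 0 := by
  have hk0 : (2 : ℝ) ≤ k := by exact_mod_cast hk
  have hsum : (∑ x, ∑ y, if P x ≠ P y ∧ c x = c y then
      w x y * (potential w k θ c P - potential w k θ c (merge P x y)) else 0) =
      cost w (fun x y => P x ≠ P y ∧ c x = c y) +
        2 * k * ∑ S ∈ richSets w k θ c P, restCost w c S := by
    unfold restCost
    rw [sum_cost]
    unfold cost
    rw [mul_sum, ← sum_add_distrib]
    refine sum_congr rfl fun x _ => ?_
    rw [mul_sum, ← sum_add_distrib]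
    refine sum_congr rfl fun y _ => ?_
    by_cases hcxy : c x = c y
    · by_cases hxy : P x = P y
      · have : ∀ S ∈ richSets w k θ c P, ¬(c x = c y ∧ ¬(x ∈ S ↔ y ∈ S)) := by
          intro S hS h
          exact h.2 (iff_of_eq ((mem_filter.1 hS).2.2 x y hxy))
        rw [filter_false_of_mem this]
        simp [hxy]
      · rw [if_pos ⟨hxy, hcxy⟩, if_pos ⟨hxy, hcxy⟩, potential_sub_merge hxy]
        simp only [hcxy, true_and]
        ring
    · simp [hcxy]
  rw [hsum, cost_ne_and_eq hP, hc]
  have h3 := sub_le_colorCost hw hθ hk h2 hc hP hPk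
  have h4 : (#(richSets w k θ c P) : ℝ) * (θ * (1 + 1 / (2 * k))) ≤
      ∑ S ∈ richSets w k θ c P, restCost w c S := by
    rw [← nsmul_eq_mul]
    exact card_nsmul_le_sum _ _ _ fun S hS => (mem_filter.1 hS).2.1
  have h5 : 2 * k * ((#(richSets w k θ c P) : ℝ) * (θ * (1 + 1 / (2 * k)))) =
      2 * k * #(richSets w k θ c P) * θ + #(richSets w k θ c P) * θ := by
    field_simp
  have h6 := mul_le_mul_of_nonneg_left h4 (show (0 : ℝ) ≤ 2 * k by linarith)
  rw [h5] at h6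
  unfold potential
  linarith

lemma one_le_potential {c : V → Finset V} {P : V → V} (hP : rank k + 1 ≤ #(univ.image P)) :
    1 ≤ potential w k θ c P := by
  have h1 : (rank k : ℝ) + 1 ≤ #(univ.image P) := by exact_mod_cast hP
  have h2 : (0 : ℝ) ≤ 2 * k * #(richSets w k θ c P) := by positivity
  unfold potential
  linarith

open Classical in
lemma card_compat_le (hk : 2 ≤ k) (P : V → V) :
    #{c ∈ minCuts w k θ | Compat P c} ≤ k ^ #(univ.image P) := by
  have : Nonempty (Fin k) := ⟨⟨0, by omega⟩⟩
  have hlab : ∀ c ∈ minCuts w k θ, ∃ e : Finset V → Fin k, Set.InjOn e (univ.image c) := by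
    intro c hc
    have hcard := (mem_minCuts.1 hc).2.1
    obtain ⟨e, -, he⟩ := (univ.image c).finite_toSet.exists_injOn_of_encard_le
      (t := (Set.univ : Set (Fin k)))
      (by rw [Set.encard_coe_eq_coe_finsetCard, hcard]; simp)
    exact ⟨e, he⟩
  choose! e he using hlab
  have hrep : ∀ a : univ.image P, ∃ x, P x = a := fun a => by
    obtain ⟨x, -, hx⟩ := mem_image.1 a.2
    exact ⟨x, hx⟩
  choose r hr using hrep
  have hcard : k ^ #(univ.image P) = #(univ : Finset (univ.image P → Fin k)) := by
    rw [card_univ, Fintype.card_fun, Fintype.card_fin, Fintype.card_coe]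
  rw [hcard]
  refine card_le_card_of_injOn (fun c a => e c (c (r a))) (fun _ _ => mem_coe.2 (mem_univ _)) ?_
  intro c hc d hd hcd
  obtain ⟨hc, hcP⟩ := mem_filter.1 (mem_coe.1 hc)
  obtain ⟨hd, hdP⟩ := mem_filter.1 (mem_coe.1 hd)
  refine (mem_minCuts.1 hc).1.eq_of_kernel (mem_minCuts.1 hd).1 fun x y => ?_
  have key : ∀ c ∈ minCuts w k θ, Compat P c → ∀ x y, c x = c y ↔
      e c (c (r ⟨P x, mem_image_of_mem P (mem_univ x)⟩)) =
        e c (c (r ⟨P y, mem_image_of_mem P (mem_univ y)⟩)) := by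
    intro c hc hcP x y
    rw [(he c hc).eq_iff (mem_coe.2 (mem_image_of_mem c (mem_univ _)))
      (mem_coe.2 (mem_image_of_mem c (mem_univ _))),
      hcP (r _) x (hr ⟨P x, _⟩), hcP (r _) y (hr ⟨P y, _⟩)]
  have hx := congrFun hcd ⟨P x, mem_image_of_mem P (mem_univ x)⟩
  have hy := congrFun hcd ⟨P y, mem_image_of_mem P (mem_univ y)⟩
  simp only at hx hy
  rw [key c hc hcP, key d hd hdP, hx, hy]

end Potential

section Count

variable {V : Type*} [Fintype V] [DecidableEq V] {w : V → V → ℝ} {θ : ℝ} {k : ℕ}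

open Classical in
/-- The average over one random contraction. -/
lemma colorCost_mul_inv_pow_le (hw : ∀ x y, 0 ≤ w x y) (hθ : 0 < θ) (hk : 2 ≤ k)
    (h2 : ∀ f : V → ℕ, #(univ.image f) = k → (k : ℝ) * θ ≤ colorCost w f)
    {c : V → Finset V} (hc : colorCost w c = k * θ) {P : V → V} (hP : Compat P c)
    (hPk : rank k + 2 ≤ #(univ.image P)) :
    colorCost w P * ((potential w k θ c P) ^ k)⁻¹ ≤ ∑ x, ∑ y, if P x ≠ P y ∧ c x = c y then
      w x y * ((potential w k θ c (merge P x y)) ^ k)⁻¹ else 0 := by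
  have hrk : k ≤ rank k := by unfold rank; nlinarith
  set A := potential w k θ c P with hA
  have hA0 : 0 < A := lt_of_lt_of_le one_pos (one_le_potential (by omega))
  have h1 := le_sum_potential_sub hw hθ hk h2 hc hP (by omega)
  have h3 : ∑ x, ∑ y, (if P x ≠ P y ∧ c x = c y then
      w x y * ((A ^ k)⁻¹ * (1 + k * ((A - potential w k θ c (merge P x y)) / A))) else 0) =
      (A ^ k)⁻¹ * (cost w (fun x y => P x ≠ P y ∧ c x = c y) + k / A *
        ∑ x, ∑ y, if P x ≠ P y ∧ c x = c y then
          w x y * (A - potential w k θ c (merge P x y)) else 0) := by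
    unfold cost
    simp only [mul_add, mul_sum, ← sum_add_distrib]
    refine sum_congr rfl fun x _ => sum_congr rfl fun y _ => ?_
    split_ifs
    · ring
    · simp
  calc colorCost w P * (A ^ k)⁻¹
      = (A ^ k)⁻¹ * (colorCost w P - k * θ + k / A * (θ * A)) := by
        field_simp
        ring
    _ ≤ (A ^ k)⁻¹ * (cost w (fun x y => P x ≠ P y ∧ c x = c y) + k / A *
        ∑ x, ∑ y, if P x ≠ P y ∧ c x = c y then
          w x y * (A - potential w k θ c (merge P x y)) else 0) := by
        rw [cost_ne_and_eq hP, hc]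
        gcongr
    _ ≤ _ := by
        rw [← h3]
        refine sum_le_sum fun x _ => sum_le_sum fun y _ => ?_
        split_ifs with hxy
        · have hB : rank k + 1 ≤ #(univ.image (merge P x y)) := by
            have := card_image_merge hxy.1
            omega
          exact mul_le_mul_of_nonneg_left (inv_pow_mul_le_inv_pow hA0
            (lt_of_lt_of_le one_pos (one_le_potential hB)) k) (hw x y)
        · exact le_rfl

open Classical in
lemma sum_inv_potential_le (hw : ∀ x y, 0 ≤ w x y) (hθ : 0 < θ) (hk : 2 ≤ k)
    (h2 : ∀ f : V → ℕ, #(univ.image f) = k → (k : ℝ) * θ ≤ colorCost w f) (n : ℕ) :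
    ∀ P : V → V, #(univ.image P) = rank k + 1 + n →
      ∑ c ∈ minCuts w k θ with Compat P c, ((potential w k θ c P) ^ k)⁻¹ ≤
        (k : ℝ) ^ (rank k + 1) := by
  induction n with
  | zero =>
    intro P hP
    calc ∑ c ∈ minCuts w k θ with Compat P c, ((potential w k θ c P) ^ k)⁻¹
        ≤ ∑ c ∈ minCuts w k θ with Compat P c, (1 : ℝ) :=
          sum_le_sum fun c _ => inv_le_one_of_one_le₀
            (one_le_pow₀ (one_le_potential (by omega)))
      _ = #{c ∈ minCuts w k θ | Compat P c} := by simp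
      _ ≤ ((k ^ #(univ.image P) : ℕ) : ℝ) := Nat.cast_le.2 (card_compat_le hk P)
      _ = (k : ℝ) ^ (rank k + 1) := by rw [hP]; push_cast; rfl
  | succ n ih =>
    intro P hP
    rcases ({c ∈ minCuts w k θ | Compat P c}).eq_empty_or_nonempty with he | ⟨c₀, hc₀⟩
    · rw [he, sum_empty]
      positivity
    obtain ⟨hc₀, hc₀P⟩ := mem_filter.1 hc₀
    have hW : 0 < colorCost w P := by
      have h1 := cost_ne_and_eq (w := w) hc₀P
      have h3 := cost_nonneg hw (fun x y => P x ≠ P y ∧ c₀ x = c₀ y)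
      rw [(mem_minCuts.1 hc₀).2.2] at h1
      have : 0 < (k : ℝ) * θ := by positivity
      linarith
    refine le_of_mul_le_mul_left ?_ hW
    rw [mul_sum]
    calc ∑ c ∈ minCuts w k θ with Compat P c, colorCost w P * ((potential w k θ c P) ^ k)⁻¹
        ≤ ∑ c ∈ minCuts w k θ with Compat P c, ∑ x, ∑ y, (if P x ≠ P y ∧ c x = c y then
            w x y * ((potential w k θ c (merge P x y)) ^ k)⁻¹ else 0) := by
          refine sum_le_sum fun c hc => ?_
          obtain ⟨hc, hcP⟩ := mem_filter.1 hc
          exact colorCost_mul_inv_pow_le hw hθ hk h2 (mem_minCuts.1 hc).2.2 hcP (by omega)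
      _ = ∑ x, ∑ y, ∑ c ∈ minCuts w k θ with Compat P c, (if P x ≠ P y ∧ c x = c y then
            w x y * ((potential w k θ c (merge P x y)) ^ k)⁻¹ else 0) := by
          rw [sum_comm]
          exact sum_congr rfl fun x _ => sum_comm
      _ ≤ ∑ x, ∑ y, (if P x ≠ P y then w x y else 0) * (k : ℝ) ^ (rank k + 1) := by
          refine sum_le_sum fun x _ => sum_le_sum fun y _ => ?_
          by_cases hxy : P x = P y
          · simp [hxy]
          · have h3 := ih (merge P x y) (by have := card_image_merge hxy; omega)
            rw [if_pos hxy]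
            refine le_trans (le_of_eq ?_) (mul_le_mul_of_nonneg_left h3 (hw x y))
            simp only [compat_merge_iff]
            rw [← filter_filter, mul_sum, sum_filter (fun c : V → Finset V => c x = c y)]
            refine sum_congr rfl fun c _ => ?_
            simp [hxy]
      _ = colorCost w P * (k : ℝ) ^ (rank k + 1) := by
          unfold colorCost cost
          simp only [sum_mul]
          refine sum_congr rfl fun x _ => sum_congr rfl fun y _ => ?_
          congr

/-- There are `O_k(|V| ^ k)` minimum `k`-cuts. -/
lemma card_minCuts_le [Nonempty V] (hw : ∀ x y, 0 ≤ w x y) (hθ : 0 < θ) (hk : 2 ≤ k)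
    (h2 : ∀ f : V → ℕ, #(univ.image f) = k → (k : ℝ) * θ ≤ colorCost w f) :
    #(minCuts w k θ) ≤
      k ^ (rank k + 1) * (Fintype.card V * (1 + 2 * k * smallConst k)) ^ k := by
  classical
  have hid : ({c ∈ minCuts w k θ | Compat (id : V → V) c}) = minCuts w k θ :=
    filter_true_of_mem fun c _ x y hxy => congrArg c hxy
  have hn : 0 < Fintype.card V := Fintype.card_pos
  have himg : #(univ.image (id : V → V)) = Fintype.card V := by simp
  have hpos : 0 < (Fintype.card V * (1 + 2 * k * smallConst k)) ^ k := by positivity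
  rcases le_or_gt (Fintype.card V) (rank k) with hle | hlt
  · have h1 := card_compat_le (w := w) (θ := θ) hk (id : V → V)
    rw [hid, himg] at h1
    calc #(minCuts w k θ) ≤ k ^ (rank k + 1) :=
          h1.trans (Nat.pow_le_pow_right (by omega) (by omega))
      _ ≤ _ := Nat.le_mul_of_pos_right _ hpos
  obtain ⟨n, hn'⟩ := Nat.exists_eq_add_of_le hlt
  have h1 := sum_inv_potential_le hw hθ hk h2 n (id : V → V) (by rw [himg, hn'])
  rw [hid] at h1
  set N : ℝ := Fintype.card V * (1 + 2 * k * smallConst k) with hN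
  have hN0 : 0 < N := by positivity
  have h3 : ∀ c ∈ minCuts w k θ, (N ^ k)⁻¹ ≤ ((potential w k θ c (id : V → V)) ^ k)⁻¹ := by
    intro c _
    have hp := one_le_potential (w := w) (k := k) (θ := θ) (c := c) (P := (id : V → V))
      (by rw [himg]; omega)
    have hs : (#(richSets w k θ c (id : V → V)) : ℝ) ≤ smallConst k * Fintype.card V := by
      exact_mod_cast (card_le_card (filter_subset _ _)).trans (card_smallSets_le hw hθ hk h2)
    have hpN : potential w k θ c (id : V → V) ≤ N := by
      have h4 := mul_le_mul_of_nonneg_left hs (show (0 : ℝ) ≤ 2 * k by positivity)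
      have h5 : (0 : ℝ) ≤ rank k := Nat.cast_nonneg _
      unfold potential
      rw [himg, hN]
      linarith
    have hp0 : 0 < potential w k θ c (id : V → V) := by linarith
    gcongr
  have h4 := (card_nsmul_le_sum _ _ _ h3).trans h1
  rw [nsmul_eq_mul, ← div_eq_mul_inv, div_le_iff₀ (by positivity)] at h4
  rw [hN] at h4
  exact_mod_cast h4

end Count

section Partition

variable {V : Type*} [Fintype V] [DecidableEq V] {w : V → V → ℝ} {k : ℕ}

lemma isCanonical_part (P : Finpartition (univ : Finset V)) : IsCanonical P.part := fun _ _ =>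
  P.mem_part_iff_part_eq_part (mem_univ _) (mem_univ _)

lemma image_part (P : Finpartition (univ : Finset V)) : univ.image P.part = P.parts := by
  ext p
  simp only [mem_image, mem_univ, true_and]
  constructor
  · rintro ⟨x, rfl⟩
    exact P.part_mem.2 (mem_univ x)
  · intro hp
    obtain ⟨x, hx⟩ := P.nonempty_of_mem_parts hp
    exact ⟨x, P.part_eq_of_mem hp hx⟩

lemma colorCost_part (P : Finpartition (univ : Finset V)) :
    colorCost w P.part = 2 * kCutWeight w P := by
  have h : ∀ x y, (∃ p ∈ P.parts, x ∈ p ∧ y ∈ p) ↔ P.part x = P.part y := fun x y => by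
    rw [← P.mem_part_iff_exists, P.mem_part_iff_part_eq_part (mem_univ _) (mem_univ _)]
  unfold colorCost cost kCutWeight
  rw [← mul_assoc, mul_one_div_cancel two_ne_zero, one_mul]
  refine sum_congr rfl fun x _ => sum_congr rfl fun y _ => ?_
  by_cases hxy : P.part x = P.part y
  · rw [if_neg (not_not.2 hxy), if_pos ((h x y).2 hxy)]
  · rw [if_pos hxy, if_neg fun hh => hxy ((h x y).1 hh)]

lemma exists_finpartition_of_coloring (f : V → ℕ) :
    ∃ P : Finpartition (univ : Finset V),
      #P.parts = #(univ.image f) ∧ 2 * kCutWeight w P = colorCost w f := by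
  classical
  let s : Setoid V := Setoid.ker f
  have h : ∀ x y, (Finpartition.ofSetoid s).part x = (Finpartition.ofSetoid s).part y ↔
      f x = f y := fun x y => by
    rw [eq_comm (a := f x), ← Finpartition.mem_part_iff_part_eq_part _ (mem_univ _) (mem_univ _),
      Finpartition.mem_part_ofSetoid_iff_rel]
    exact Iff.rfl
  refine ⟨Finpartition.ofSetoid s, ?_, ?_⟩
  · rw [← image_part, card_image_eq_of_kernel h]
  · rw [← colorCost_part, colorCost_eq_of_kernel h]

end Partition

section Numerics

lemma chainBound_le (m L : ℕ) : chainBound m L ≤ (m * m + 1) ^ L := by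
  induction L with
  | zero => simp [chainBound]
  | succ L ih =>
    have h1 : 1 ≤ (m * m + 1) ^ L := Nat.one_le_pow _ _ (Nat.succ_pos _)
    have h2 := Nat.mul_le_mul_left (m * m) ih
    rw [chainBound, pow_succ', add_mul, one_mul]
    exact Nat.add_le_add h2 h1

variable {k : ℕ}

lemma chainBound_le_pow (hk : 2 ≤ k) : chainBound (2 * (k - 1)) (k - 2) ≤ k ^ (4 * k) := by
  obtain ⟨j, rfl⟩ := Nat.exists_eq_add_of_le' hk
  refine (chainBound_le _ _).trans ?_
  have h1 : 2 * (j + 2 - 1) * (2 * (j + 2 - 1)) + 1 ≤ (j + 2) ^ 4 := by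
    have h2 : 4 ≤ (j + 2) ^ 2 := by nlinarith
    have h3 := Nat.mul_le_mul_right ((j + 2) ^ 2) h2
    rw [← pow_add] at h3
    refine le_trans ?_ h3
    rw [show j + 2 - 1 = j + 1 by omega]
    nlinarith
  calc _ ≤ ((j + 2) ^ 4) ^ (j + 2 - 2) := Nat.pow_le_pow_left h1 _
    _ = (j + 2) ^ (4 * (j + 2 - 2)) := (pow_mul _ _ _).symm
    _ ≤ _ := Nat.pow_le_pow_right (by omega) (by omega)

lemma traceConst_le {α : ℕ} (hα : 1 ≤ α) (hk : 2 ≤ k) (h : α ≤ k ^ (4 * k)) :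
    TraceFamily.traceConst α k ≤ k ^ (9 * k + 8) := by
  have hk1 : 1 ≤ k := by omega
  have hpow : ∀ i, 2 ^ i ≤ k ^ i := fun i => Nat.pow_le_pow_left hk i
  have h1 : 4 * 2 ^ k * α * α ≤ k ^ (9 * k + 6) :=
    calc 4 * 2 ^ k * α * α ≤ k ^ 2 * k ^ k * k ^ (4 * k) * k ^ (4 * k) := by
          gcongr
          · exact hpow 2
      _ = k ^ (9 * k + 2) := by ring
      _ ≤ _ := Nat.pow_le_pow_right hk1 (by omega)
  have h2 : 2 * (α * (2 * k) + 1) ≤ k ^ (9 * k + 6) :=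
    calc 2 * (α * (2 * k) + 1) ≤ 2 ^ 3 * k * α := by nlinarith [Nat.mul_le_mul hα hk1]
      _ ≤ k ^ 3 * k * k ^ (4 * k) := by
          gcongr
      _ = k ^ (4 * k + 4) := by ring
      _ ≤ _ := Nat.pow_le_pow_right hk1 (by omega)
  have h3 : 2 * (2 * k * (α * (2 * k)) + 1) ≤ k ^ (9 * k + 6) :=
    calc 2 * (2 * k * (α * (2 * k)) + 1) ≤ 2 ^ 4 * (k * k) * α := by
          nlinarith [Nat.mul_le_mul hα (Nat.mul_le_mul hk1 hk1)]
      _ ≤ k ^ 4 * (k * k) * k ^ (4 * k) := by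
          gcongr
      _ = k ^ (4 * k + 6) := by ring
      _ ≤ _ := Nat.pow_le_pow_right hk1 (by omega)
  have h4 : 2 ^ (2 * k) ≤ k ^ (9 * k + 6) :=
    (hpow _).trans (Nat.pow_le_pow_right hk1 (by omega))
  calc TraceFamily.traceConst α k ≤ 2 ^ 2 * k ^ (9 * k + 6) := by
        unfold TraceFamily.traceConst
        omega
    _ ≤ k ^ 2 * k ^ (9 * k + 6) := by
        gcongr
    _ = _ := by ring

lemma smallConst_le (hk : 2 ≤ k) : 1 + 2 * k * smallConst k ≤ k ^ (10 * k + 13) := by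
  have hk1 : 1 ≤ k := by omega
  have h1 : baseConst k ≤ k ^ (9 * k + 8) :=
    traceConst_le (chainBound_pos _ _) hk (chainBound_le_pow hk)
  have h2 : 1 ≤ k ^ (9 * k + 8) := Nat.one_le_pow _ _ hk1
  have h3 : smallConst k ≤ k ^ (10 * k + 10) :=
    calc smallConst k ≤ k ^ k * (2 ^ 2 * k ^ (9 * k + 8)) := by
          unfold smallConst
          gcongr
          omega
      _ ≤ k ^ k * (k ^ 2 * k ^ (9 * k + 8)) := by gcongr
      _ = _ := by ring
  have h4 : 1 ≤ k * k ^ (10 * k + 10) := Nat.mul_pos hk1 (Nat.pow_pos hk1)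
  calc 1 + 2 * k * smallConst k ≤ 1 + 2 * k * k ^ (10 * k + 10) := by gcongr
    _ ≤ 2 ^ 2 * (k * k ^ (10 * k + 10)) := by
        rw [mul_assoc]
        omega
    _ ≤ k ^ 2 * (k * k ^ (10 * k + 10)) := by gcongr
    _ = _ := by ring

lemma countConst_le (hk : 2 ≤ k) (n : ℕ) :
    k ^ (rank k + 1) * (n * (1 + 2 * k * smallConst k)) ^ k ≤ n ^ k * k ^ (30 * k ^ 2) :=
  calc k ^ (rank k + 1) * (n * (1 + 2 * k * smallConst k)) ^ k
      ≤ k ^ (rank k + 1) * (n * k ^ (10 * k + 13)) ^ k := by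
        gcongr
        exact smallConst_le hk
    _ = n ^ k * k ^ (rank k + 1 + (10 * k + 13) * k) := by
        rw [mul_pow, ← pow_mul, pow_add]
        ring
    _ ≤ n ^ k * k ^ (30 * k ^ 2) := by
        refine Nat.mul_le_mul_left _ (Nat.pow_le_pow_right (by omega) ?_)
        unfold rank
        nlinarith

end Numerics

end KCut

/-- There is an absolute constant `C > 0` such that for every integer `k ≥ 2` and every
weighted multigraph on a vertex set `V` with `|V| = n ≥ k` and `λ_k > 0`, the number of
minimum-weight `k`-cuts is at most `n^k * k^(C·k²)`. -/
theorem number_of_minimum_k_cuts :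
    ∃ C : ℝ, 0 < C ∧
      ∀ (k : ℕ) (V : Type) [Fintype V] [DecidableEq V] (w : V → V → ℝ) (lam : ℝ),
        2 ≤ k →
        k ≤ Fintype.card V →
        (∀ u v, w u v = w v u) →
        (∀ u v, 0 ≤ w u v) →
        (∀ v, w v v = 0) →
        (∃ P : Finpartition (univ : Finset V), P.parts.card = k ∧ kCutWeight w P = lam) →
        (∀ P : Finpartition (univ : Finset V), P.parts.card = k → lam ≤ kCutWeight w P) →
        0 < lam →
        ({P : Finpartition (univ : Finset V) |
            P.parts.card = k ∧ kCutWeight w P = lam}.ncard : ℝ) ≤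
          (Fintype.card V : ℝ) ^ k * (k : ℝ) ^ (C * (k : ℝ) ^ 2) := by
  refine ⟨30, by norm_num, ?_⟩
  intro k V _ _ w lam hk hkV _ hw _ _ hmin hlam
  have hk0 : (0 : ℝ) < k := by exact_mod_cast (by omega : 0 < k)
  have hV : Nonempty V := Fintype.card_pos_iff.1 (by omega)
  have hkθ : (k : ℝ) * (2 * lam / k) = 2 * lam := mul_div_cancel₀ _ hk0.ne'
  have h2 : ∀ f : V → ℕ, #(univ.image f) = k →
      (k : ℝ) * (2 * lam / k) ≤ KCut.colorCost w f := by
    intro f hf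
    obtain ⟨P, hP, hPw⟩ := KCut.exists_finpartition_of_coloring (w := w) f
    have := hmin P (hP.trans hf)
    rw [hkθ, ← hPw]
    linarith
  have hcount := KCut.card_minCuts_le hw (by positivity) hk h2
  have hinj : {P : Finpartition (univ : Finset V) |
      P.parts.card = k ∧ kCutWeight w P = lam}.ncard ≤
        #(KCut.minCuts w k (2 * lam / k)) := by
    rw [← Set.ncard_coe_finset]
    refine Set.ncard_le_ncard_of_injOn (fun P => P.part) ?_ ?_ (finite_toSet _)
    · rintro P ⟨hP, hPw⟩
      refine mem_coe.2 (KCut.mem_minCuts.2 ⟨KCut.isCanonical_part P, ?_, ?_⟩)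
      · rw [KCut.image_part, hP]
      · rw [KCut.colorCost_part, hPw, hkθ]
    · intro P _ Q _ hPQ
      have hPQ' : P.part = Q.part := hPQ
      ext1
      rw [← KCut.image_part, ← KCut.image_part, hPQ']
  have hexp : (30 : ℝ) * (k : ℝ) ^ 2 = ((30 * k ^ 2 : ℕ) : ℝ) := by push_cast; ring
  rw [hexp, Real.rpow_natCast]
  exact_mod_cast hinj.trans (hcount.trans (KCut.countConst_le hk _))
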